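/- Let K' be a field of characteristic zero, let d ≥ 3 and 2d−2 ≤ q < r, and let G = Σ_{|I|<2d} b_{I,J} Z^I Y^J be homogeneous of degree 2d in Z_0,…,Z_q, Y_{q+1},…,Y_r with every monomial involving a Y-variable and all coefficients algebraically independent over K'. Let η = (1,η_1,…,η_{2d−2},0,…,0) with η_1,…,η_{2d−2} algebraically independent over K'(b). Let F*_η be the subvariety of P^r defined by Z_0 = 0 together with the polar equations Δ^j_η(G) = 0 for j = 1,…,2d−2; assume F*_η is irreducible of dimension r−2d+1 over K'(b,η) (as follows from genericity), and let ξ = (0, 1, ξ_2,…,ξ_r) be a point of F*_η whose coordinates satisfy trdeg_{K'(b,η)} K'(b,η)(ξ_2,…,ξ_r) = r−2d+1 (a generic point of F*_η over K'(b,η)). Then f(t) := G(η + tξ) ∈ K'(b,η,ξ)[t] has the form f(t) = t^{2d−1}(A + Bt) with A, B ∈ K'(b,η,ξ) both nonzero, and the residual intersection point β := η + t_0 ξ = (1, β_1,…,β_r), where t_0 = −A/B, satisfies trdeg_{K'(b)} K'(b)(β_1,…,β_r) = r − 1; that is, β is a generic point of the hypersurface B = {G = 0} over K'_1 = K'(b).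 -/

import Mathlib

set_option synthInstance.maxHeartbeats 1000000
set_option maxHeartbeats 1000000

universe u

/-- The `j`-th polar of the point `η` with respect to the (homogeneous) polynomial `G`:
the polynomial in `X = (X_0, …, X_{n-1})` obtained by applying the derivation
`X_0 ∂/∂U_0 + … + X_{n-1} ∂/∂U_{n-1}` to `G(U)` `j` times and then evaluating at
`U = η`. -/
noncomputable def polar {R : Type*} [CommRing R] {n : ℕ}
    (G : MvPolynomial (Fin n) R) (η : Fin n → R) (j : ℕ) : MvPolynomial (Fin n) R :=
  MvPolynomial.aeval (Sum.elim (fun i => MvPolynomial.C (η i)) MvPolynomial.X)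
    ((fun p => ∑ i : Fin n,
        MvPolynomial.X (Sum.inr i) * MvPolynomial.pderiv (Sum.inl i) p)^[j]
      (MvPolynomial.rename Sum.inl G))

/-- `FieldTrdegEq F Ω s n` says that the subfield `F(s)` of `Ω` generated over `F` by
the set `s` has transcendence degree `n` over `F`: there is a transcendence basis of
`F(s)/F` consisting of `n` elements. -/
def FieldTrdegEq (F Ω : Type*) [Field F] [Field Ω] [Algebra F Ω] (s : Set Ω) (n : ℕ) :
    Prop :=
  ∃ v : Fin n → Ω, AlgebraicIndependent F v ∧
    (∀ i, v i ∈ IntermediateField.adjoin F s) ∧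
    ∀ x ∈ s, IsAlgebraic (↥(IntermediateField.adjoin F (Set.range v))) x


open AlgebraicIndependent in
theorem mem_closure_iff_isAlgebraic {K Ω : Type*} [Field K] [Field Ω] [Algebra K Ω] (s : Set Ω) (a : Ω) :
    a ∈ (matroid K Ω).closure s ↔ IsAlgebraic (IntermediateField.adjoin K s) a := by
  rw [matroid_closure_eq]
  change IsAlgebraic (Algebra.adjoin K s) a ↔ _
  open scoped IntermediateField.algebraAdjoinAdjoin in
  exact IsFractionRing.isAlgebraic_iff (Algebra.adjoin K s) (IntermediateField.adjoin K s) Ω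

open AlgebraicIndependent in
theorem algInd_of_card {K Ω : Type*} [Field K] [Field Ω] [Algebra K Ω] {ι κ : Type*}
    [Fintype ι] [Fintype κ] (x : ι → Ω) (y : κ → Ω) (hx : AlgebraicIndependent K x)
    (hcard : Fintype.card κ ≤ Fintype.card ι)
    (halg : ∀ i, IsAlgebraic (IntermediateField.adjoin K (Set.range y)) (x i)) :
    AlgebraicIndependent K y := by
  have h1 : (matroid K Ω).Indep (Set.range x) := hx.coe_range
  have h2 : Set.range x ⊆ (matroid K Ω).closure (Set.range y) := by
    rintro _ ⟨i, rfl⟩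
    exact (mem_closure_iff_isAlgebraic _ _).2 (halg i)
  have e1 : (Set.range x).encard = Fintype.card ι := by
    rw [← Set.image_univ, hx.injective.encard_image, Set.encard_univ, ENat.card_eq_coe_fintype_card]
  have e2 : (Set.range x).encard ≤ (matroid K Ω).eRk (Set.range y) := by
    rw [← Matroid.eRk_closure_eq, ← h1.eRk_eq_encard]
    exact Matroid.eRk_mono _ h2
  have e3 : (Set.range y).encard ≤ Fintype.card κ := by
    rw [← Set.image_univ]
    refine (Set.encard_image_le _ _).trans ?_
    rw [Set.encard_univ, ENat.card_eq_coe_fintype_card]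
  have e4 := (matroid K Ω).eRk_le_encard (Set.range y)
  have e5 : (Fintype.card κ : ℕ∞) ≤ Fintype.card ι := by exact_mod_cast hcard
  have e6 : (Fintype.card κ : ℕ∞) ≤ (Set.range y).encard := by
    exact (e5.trans e1.ge).trans (e2.trans e4)
  have hind : (matroid K Ω).Indep (Set.range y) := by
    rw [Matroid.indep_iff_eRk_eq_encard_of_finite (Set.finite_range y)]
    exact le_antisymm e4 ((e3.trans (e5.trans e1.ge)).trans e2)
  have hinj : Function.Injective y := by
    have hc : Fintype.card κ ≤ (Set.range y).ncard := by
      rw [← (Set.finite_range y).cast_ncard_eq] at e6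
      exact_mod_cast e6
    classical
    have : (Finset.univ.image y).card = (Finset.univ : Finset κ).card := by
      apply le_antisymm Finset.card_image_le
      rw [← Set.ncard_coe_finset (Finset.image y Finset.univ), Finset.coe_image, Finset.coe_univ, Set.image_univ]; exact hc
    have := Finset.card_image_iff.1 this
    simpa using this
  have hh : AlgebraicIndependent K ((↑) : Set.range y → Ω) := hind
  exact (algebraicIndependent_subtype_range hinj).1 hh

open AlgebraicIndependent in
theorem fieldTrdegEq_of {K Ω : Type*} [Field K] [Field Ω] [Algebra K Ω] {ι : Type*}
    [Fintype ι] (z : ι → Ω) (hz : AlgebraicIndependent K z) (s : Set Ω)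
    (h1 : ∀ i, IsAlgebraic (IntermediateField.adjoin K s) (z i))
    (h2 : ∀ a ∈ s, IsAlgebraic (IntermediateField.adjoin K (Set.range z)) a) (n : ℕ)
    (hn : Fintype.card ι = n) :
    FieldTrdegEq K Ω s n := by
  obtain ⟨I, hI⟩ := (matroid K Ω).exists_isBasis s
  have h1' : Set.range z ⊆ (matroid K Ω).closure s := by
    rintro _ ⟨i, rfl⟩
    exact (mem_closure_iff_isAlgebraic _ _).2 (h1 i)
  have h2' : s ⊆ (matroid K Ω).closure (Set.range z) := fun a ha =>
    (mem_closure_iff_isAlgebraic _ _).2 (h2 a ha)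
  have hzi : (matroid K Ω).Indep (Set.range z) := hz.coe_range
  have e1 : (Set.range z).encard = n := by
    rw [← Set.image_univ, hz.injective.encard_image, Set.encard_univ, ENat.card_eq_coe_fintype_card, hn]
  have e : I.encard = n := by
    rw [hI.encard_eq_eRk, ← e1, ← hzi.eRk_eq_encard]
    apply le_antisymm
    · rw [← Matroid.eRk_closure_eq _ (Set.range z)]; exact Matroid.eRk_mono _ h2'
    · rw [← Matroid.eRk_closure_eq _ s]; exact Matroid.eRk_mono _ h1'
  have hfin : I.Finite := Set.finite_of_encard_eq_coe e
  have : Fintype I := hfin.fintype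
  have hc : Fintype.card I = n := by
    rw [Set.encard_eq_coe_toFinset_card] at e
    rw [← Set.toFinset_card]; exact_mod_cast e
  let eq := (Fintype.equivFinOfCardEq hc).symm
  have hIi : AlgebraicIndependent K ((↑) : I → Ω) := hI.indep
  have hr : Set.range (fun i => (eq i : Ω)) = I := by
    have := eq.surjective.range_comp ((↑) : I → Ω)
    rw [Subtype.range_coe] at this
    exact this
  refine ⟨fun i => (eq i : Ω), hIi.comp eq eq.injective, fun i => ?_, fun a ha => ?_⟩
  · exact IntermediateField.subset_adjoin _ _ (hI.subset (eq i).2)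
  · rw [hr]
    exact (mem_closure_iff_isAlgebraic _ _).1 (hI.subset_closure ha)

theorem chain_rule {R S σ A : Type*} [CommRing R] [CommRing S] [CommRing A] [Algebra R S]
    [Algebra A S] [Fintype σ] (δ : Derivation A S S)
    (hδ : ∀ c : R, δ (algebraMap R S c) = 0) (x : σ → S) (P : MvPolynomial σ R) :
    δ (MvPolynomial.aeval x P) =
      ∑ i, MvPolynomial.aeval x (MvPolynomial.pderiv i P) * δ (x i) := by
  classical
  induction P using MvPolynomial.induction_on with
  | C a => simp [hδ, MvPolynomial.algHom_C]
  | add p q hp hq => simp [hp, hq, add_mul, Finset.sum_add_distrib]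
  | mul_X p i hp =>
    simp only [map_mul, Derivation.leibniz, hp, MvPolynomial.aeval_X, smul_eq_mul,
      MvPolynomial.pderiv_X, map_add, add_mul, Finset.sum_add_distrib, Pi.single_apply]
    congr 1
    · simp [Finset.sum_ite_eq, apply_ite, ite_mul]
    · rw [Finset.mul_sum]
      exact Finset.sum_congr rfl fun j _ => by ring

/-- coefficientwise derivation -/
noncomputable def coeffDer {R A : Type*} [CommRing R] [CommRing A] [Algebra R A]
    (D : Derivation R A A) : Derivation R (Polynomial A) (Polynomial A) :=
  Derivation.mk' 
    { toFun := fun p => PolynomialModule.equivPolynomialSelf (D.mapCoeffs p)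
      map_add' := fun p q => by simp
      map_smul' := fun c p => by
        ext n
        change D ((c • p).coeff n) = (c • (PolynomialModule.equivPolynomialSelf (D.mapCoeffs p))).coeff n
        rw [Polynomial.coeff_smul, Polynomial.coeff_smul, D.map_smul]; rfl }
    (fun p q => by
      change PolynomialModule.equivPolynomialSelf (D.mapCoeffs (p * q)) =
        p • PolynomialModule.equivPolynomialSelf (D.mapCoeffs q) +
        q • PolynomialModule.equivPolynomialSelf (D.mapCoeffs p)
      rw [Derivation.leibniz, map_add, map_smul, map_smul])

theorem coeff_coeffDer {R A : Type*} [CommRing R] [CommRing A] [Algebra R A]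
    (D : Derivation R A A) (p : Polynomial A) (n : ℕ) :
    (coeffDer D p).coeff n = D (p.coeff n) := rfl

theorem aeval_polar {R A : Type*} [CommRing R] [CommRing A] [Algebra R A] {n : ℕ}
    (G : MvPolynomial (Fin n) R) (η : Fin n → R) (j : ℕ) (x : Fin n → A) :
    MvPolynomial.aeval x (polar G η j) = (j.factorial : A) *
      (MvPolynomial.aeval (fun i => Polynomial.C (algebraMap R A (η i)) +
        Polynomial.X * Polynomial.C (x i)) G).coeff j := by
  set Φ : MvPolynomial (Fin n ⊕ Fin n) R →ₐ[R] Polynomial A :=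
    MvPolynomial.aeval (Sum.elim (fun i => Polynomial.C (algebraMap R A (η i)) +
        Polynomial.X * Polynomial.C (x i)) (fun i => Polynomial.C (x i))) with hΦ
  have key : ∀ P, Φ (∑ i : Fin n,
        MvPolynomial.X (Sum.inr i) * MvPolynomial.pderiv (Sum.inl i) P) =
        Polynomial.derivative (Φ P) := by
    intro P
    have := chain_rule (R := R) (A := A) (Polynomial.derivative' (R := A))
      (fun c => by
        rw [IsScalarTower.algebraMap_apply R A (Polynomial A)]
        simp)
      (Sum.elim (fun i => Polynomial.C (algebraMap R A (η i)) +
        Polynomial.X * Polynomial.C (x i)) (fun i => Polynomial.C (x i))) P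
    simp only [Polynomial.derivative'_apply] at this
    rw [hΦ, this, Fintype.sum_sum_type]
    simp only [Sum.elim_inl, Sum.elim_inr, Polynomial.derivative_C, mul_zero,
      Finset.sum_const_zero, add_zero, map_sum, map_mul, MvPolynomial.aeval_X,
      Polynomial.derivative_add, Polynomial.derivative_mul, Polynomial.derivative_X, one_mul, zero_add]
    exact Finset.sum_congr rfl fun i _ => mul_comm _ _
  have key2 : ∀ P, Φ ((fun p => ∑ i : Fin n,
        MvPolynomial.X (Sum.inr i) * MvPolynomial.pderiv (Sum.inl i) p)^[j] P) =
        Polynomial.derivative^[j] (Φ P) := by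
    intro P
    induction j generalizing P with
    | zero => rfl
    | succ j ih => rw [Function.iterate_succ_apply, Function.iterate_succ_apply, ih, key]
  have h3 : ∀ P, MvPolynomial.aeval x (MvPolynomial.aeval
      (Sum.elim (fun i => MvPolynomial.C (η i)) (MvPolynomial.X (R := R))) P) = (Φ P).coeff 0 := by
    intro P
    rw [Polynomial.coeff_zero_eq_aeval_zero]
    have : (MvPolynomial.aeval x).comp (MvPolynomial.aeval
      (Sum.elim (fun i => MvPolynomial.C (η i)) (MvPolynomial.X (R := R)))) =
      ((Polynomial.aeval (0:A)).restrictScalars R).comp Φ := by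
      ext i
      rcases i with i | i <;> simp [hΦ, MvPolynomial.algHom_C]
    exact DFunLike.congr_fun this P
  rw [polar, h3, key2, Polynomial.coeff_iterate_derivative, hΦ, MvPolynomial.aeval_rename]
  simp [Nat.descFactorial_self, Function.comp_def]

/-- polynomials with coefficients in a subfield -/
def polyIn {K Ω : Type*} [Field K] [Field Ω] [Algebra K Ω] (E : IntermediateField K Ω) :
    Subring (Polynomial Ω) where
  carrier := {p | ∀ n, p.coeff n ∈ E}
  mul_mem' := fun {p q} hp hq n => by
    rw [Polynomial.coeff_mul]
    exact sum_mem fun x _ => mul_mem (hp _) (hq _)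
  one_mem' := fun n => by
    rw [Polynomial.coeff_one]; split_ifs; exacts [one_mem _, zero_mem _]
  add_mem' := fun {p q} hp hq n => by
    rw [Polynomial.coeff_add]; exact add_mem (hp n) (hq n)
  zero_mem' := fun n => by rw [Polynomial.coeff_zero]; exact zero_mem _
  neg_mem' := fun {p} hp n => by rw [Polynomial.coeff_neg]; exact neg_mem (hp n)

section polyIn
variable {K Ω : Type*} [Field K] [Field Ω] [Algebra K Ω] (E : IntermediateField K Ω)

theorem C_mem_polyIn {a : Ω} (ha : a ∈ E) : Polynomial.C a ∈ polyIn E := fun n => by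
  rw [Polynomial.coeff_C]; split_ifs; exacts [ha, zero_mem _]

theorem X_mem_polyIn : (Polynomial.X : Polynomial Ω) ∈ polyIn E := fun n => by
  rw [Polynomial.coeff_X]; split_ifs; exacts [one_mem _, zero_mem _]

theorem derivative_mem_polyIn {p : Polynomial Ω} (hp : p ∈ polyIn E) :
    Polynomial.derivative p ∈ polyIn E := fun n => by
  rw [Polynomial.coeff_derivative]
  exact mul_mem (hp _) (add_mem (natCast_mem _ _) (one_mem _))

theorem comp_mem_polyIn {p q : Polynomial Ω} (hp : p ∈ polyIn E) (hq : q ∈ polyIn E) :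
    p.comp q ∈ polyIn E := by
  rw [Polynomial.comp_eq_sum_left, Polynomial.sum_def]
  exact sum_mem fun i _ => mul_mem (C_mem_polyIn E (hp i)) (pow_mem hq i)

theorem aeval_mem_polyIn {σ : Type*} (Q : MvPolynomial σ Ω) (hQ : ∀ μ, Q.coeff μ ∈ E)
    (p : σ → Polynomial Ω) (hp : ∀ i, p i ∈ polyIn E) : MvPolynomial.aeval p Q ∈ polyIn E := by
  rw [MvPolynomial.aeval_def, MvPolynomial.eval₂_eq]
  refine sum_mem fun μ _ => mul_mem ?_ (prod_mem fun i _ => pow_mem (hp i) _)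
  exact C_mem_polyIn E (hQ μ)

theorem cancel_polyIn {c : Ω} (hc : c ∈ E) (hc0 : c ≠ 0) {p : Polynomial Ω}
    (h : Polynomial.X * Polynomial.C c * p ∈ polyIn E) : p ∈ polyIn E := fun n => by
  have := h (n + 1)
  rw [mul_assoc, Polynomial.coeff_X_mul, Polynomial.coeff_C_mul] at this
  have := mul_mem (inv_mem hc) this
  rwa [inv_mul_cancel_left₀ hc0] at this

/-- shifted sums -/
noncomputable def shiftSum {n : ℕ} (c : Fin n → Ω) (a : Ω) : Polynomial Ω :=
  ∑ k, Polynomial.C (c k) * (Polynomial.C a + Polynomial.X) ^ (k : ℕ)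

theorem shiftSum_natDegree {n : ℕ} (c : Fin n → Ω) (a : Ω) (j : ℕ) (hj : n ≤ j) :
    (shiftSum c a).coeff j = 0 := by
  rw [shiftSum, Polynomial.finsetSum_coeff]
  refine Finset.sum_eq_zero fun k _ => ?_
  rw [Polynomial.coeff_C_mul, add_comm, Polynomial.coeff_X_add_C_pow,
    Nat.choose_eq_zero_of_lt (k.2.trans_le hj)]
  simp

theorem mem_of_shiftSum {n : ℕ} (c : Fin n → Ω) {a : Ω} (ha : a ∈ E)
    (h : shiftSum c a ∈ polyIn E) (k : Fin n) : c k ∈ E := by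
  have h1 : (shiftSum c a).comp (Polynomial.X - Polynomial.C a) ∈ polyIn E :=
    comp_mem_polyIn E h (sub_mem (X_mem_polyIn E) (C_mem_polyIn E ha))
  have h2 := h1 k
  have h3 : (shiftSum c a).comp (Polynomial.X - Polynomial.C a) =
      ∑ k : Fin n, Polynomial.C (c k) * Polynomial.X ^ (k : ℕ) := by
    rw [shiftSum, Polynomial.comp, Polynomial.eval₂_finsetSum]
    refine Finset.sum_congr rfl fun k _ => ?_
    change (Polynomial.C (c k) * (Polynomial.C a + Polynomial.X) ^ (k : ℕ)).comp _ = _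
    simp
  rw [h3, Polynomial.finsetSum_coeff] at h2
  simpa [Polynomial.coeff_X_pow, Fin.val_inj, Finset.sum_ite_eq] using h2

theorem pderiv_coeff_mem {σ : Type*} (Q : MvPolynomial σ Ω) (hQ : ∀ μ, Q.coeff μ ∈ E) (i : σ) (μ) :
    (MvPolynomial.pderiv i Q).coeff μ ∈ E := by
  rw [MvPolynomial.coeff_pderiv]
  exact mul_mem (hQ _) (add_mem (natCast_mem _ _) (one_mem _))

theorem decomp_coeff_mem {σ Sp : Type*} [Fintype Sp] (G : MvPolynomial σ Ω)
    (m : Sp → σ →₀ ℕ) (hm : Function.Injective m)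
    (h : ∀ μ, μ ∉ Set.range m → G.coeff μ ∈ E) (μ) :
    (G - ∑ s, MvPolynomial.monomial (m s) (G.coeff (m s))).coeff μ ∈ E := by
  classical
  rw [MvPolynomial.coeff_sub, MvPolynomial.coeff_sum]
  simp only [MvPolynomial.coeff_monomial]
  by_cases hμ : μ ∈ Set.range m
  · obtain ⟨s, rfl⟩ := hμ
    have : ∑ x, (if m x = m s then G.coeff (m x) else 0) = G.coeff (m s) := by
      rw [Finset.sum_eq_single s]
      · simp
      · intro b _ hb; rw [if_neg fun hh => hb (hm hh)]
      · simp
    rw [this, sub_self]; exact zero_mem _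
  · rw [Finset.sum_eq_zero, sub_zero]
    · exact h μ hμ
    · intro s _
      rw [if_neg]; rintro rfl; exact hμ ⟨s, rfl⟩

end polyIn

/-- binary forms -/
noncomputable def binForm {Ω : Type*} [Field Ω] {r : ℕ} (v : Fin (r + 1)) (n N : ℕ) (c : Fin n → Ω) :
    MvPolynomial (Fin (r + 1)) Ω :=
  ∑ k, MvPolynomial.C (c k) * MvPolynomial.X 0 ^ (N - k) * MvPolynomial.X v ^ (k : ℕ)

section binForm
variable {Ω : Type*} [Field Ω] {r : ℕ}

theorem binForm_pderiv (v : Fin (r + 1)) (n N : ℕ) (c : Fin n → Ω) (i : Fin (r + 1))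
    (h0 : i ≠ 0) (hv : i ≠ v) : MvPolynomial.pderiv i (binForm v n N c) = 0 := by
  rw [binForm, map_sum]
  refine Finset.sum_eq_zero fun k _ => ?_
  simp [Derivation.leibniz, Derivation.leibniz_pow, MvPolynomial.pderiv_X_of_ne h0.symm,
    MvPolynomial.pderiv_X_of_ne hv.symm]

theorem binForm_aeval (v : Fin (r + 1)) (n N : ℕ) (c : Fin n → Ω) (p : Fin (r + 1) → Polynomial Ω)
    (a : Ω) (h0 : p 0 = 1) (hv : p v = Polynomial.C a + Polynomial.X) :
    MvPolynomial.aeval p (binForm v n N c) = shiftSum c a := by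
  simp [binForm, shiftSum, h0, hv, MvPolynomial.algHom_C]

theorem binForm_aeval_pderiv (v : Fin (r + 1)) (n N : ℕ) (c : Fin n → Ω)
    (p : Fin (r + 1) → Polynomial Ω)
    (a : Ω) (h0 : p 0 = 1) (hv : p v = Polynomial.C a + Polynomial.X) :
    MvPolynomial.aeval p (MvPolynomial.pderiv v (binForm v n N c)) =
      Polynomial.derivative (shiftSum c a) := by
  have := chain_rule (R := Ω) (A := Ω) (Polynomial.derivative' (R := Ω)) (fun c => by simp) p
    (binForm v n N c)
  rw [binForm_aeval v n N c p a h0 hv, Polynomial.derivative'_apply] at this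
  rw [this, Finset.sum_eq_single v]
  · rw [hv]; simp
  · intro i _ hi
    by_cases hi0 : i = 0
    · subst hi0; rw [h0]; simp
    · rw [binForm_pderiv _ _ _ _ _ hi0 hi]; simp
  · simp

theorem binForm_mul (v : Fin (r + 1)) (n N : ℕ) (c : Fin n → Ω) (ν : Fin (r + 1) →₀ ℕ) :
    binForm v n N c * MvPolynomial.monomial ν 1 = ∑ k : Fin n, MvPolynomial.monomial
      (Finsupp.single 0 (N - k) + Finsupp.single v (k : ℕ) + ν) (c k) := by
  rw [binForm, Finset.sum_mul]
  refine Finset.sum_congr rfl fun k _ => ?_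
  rw [MvPolynomial.X_pow_eq_monomial, MvPolynomial.X_pow_eq_monomial, MvPolynomial.C_mul_monomial,
    MvPolynomial.monomial_mul, MvPolynomial.monomial_mul]
  simp
end binForm

/-- special exponents, degenerate case -/
noncomputable def sp0 {r q : ℕ} (v : Fin (r + 1)) (n N : ℕ)
    (s : {i : Fin (r + 1) // q < (i : ℕ)} × Fin n) : Fin (r + 1) →₀ ℕ :=
  Finsupp.single 0 (N - s.2) + Finsupp.single v (s.2 : ℕ) + Finsupp.single s.1.1 1

theorem sp0_injective {r q : ℕ} (v : Fin (r + 1)) (n N : ℕ) (hv0 : v ≠ 0) (hvq : (v : ℕ) ≤ q) :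
    Function.Injective (sp0 (q := q) v n N) := by
  rintro ⟨⟨y, hy⟩, k⟩ ⟨⟨y', hy'⟩, k'⟩ h
  have hyv : y ≠ v := by rintro rfl; omega
  have hyv' : y' ≠ v := by rintro rfl; omega
  have h1 := DFunLike.congr_fun h v
  simp only [sp0, Finsupp.add_apply, Finsupp.single_apply, hv0.symm, hyv, hyv'] at h1
  simp at h1
  have hk : k = k' := Fin.ext h1
  subst hk
  simp only [sp0, add_right_inj] at h
  have := (Finsupp.single_left_inj one_ne_zero).1 h
  subst this
  rfl

theorem solve0 {K Ω : Type*} [Field K] [Field Ω] [Algebra K Ω] (E : IntermediateField K Ω)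
    {r q : ℕ} (v : Fin (r + 1)) (n N : ℕ) (hv0 : v ≠ 0) (hvq : (v : ℕ) ≤ q)
    (G : MvPolynomial (Fin (r + 1)) Ω)
    (hG : ∀ μ, μ ∉ Set.range (sp0 (q := q) v n N) → G.coeff μ ∈ E)
    (p : Fin (r + 1) → Polynomial Ω) (hp : ∀ i, p i ∈ polyIn E) (a : Ω) (ha : a ∈ E)
    (hp0 : p 0 = 1) (hpv : p v = Polynomial.C a + Polynomial.X)
    (hT : ∀ i : Fin (r + 1), q < (i : ℕ) → ∀ k < n,
      (MvPolynomial.aeval p (MvPolynomial.pderiv i G)).coeff k ∈ E)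
    (s) : G.coeff (sp0 (q := q) v n N s) ∈ E := by
  classical
  have hdec := decomp_coeff_mem E G (sp0 (q := q) v n N) (sp0_injective v n N hv0 hvq) hG
  set S := ∑ s, MvPolynomial.monomial (sp0 (q := q) v n N s) (G.coeff (sp0 (q := q) v n N s)) with hS
  set c : {i : Fin (r + 1) // q < (i : ℕ)} → Fin n → Ω := fun y k =>
    G.coeff (sp0 (q := q) v n N (y, k)) with hc
  have hS2 : S = ∑ y, binForm v n N (c y) * MvPolynomial.X y.1 := by
    rw [hS, Fintype.sum_prod_type]
    refine Finset.sum_congr rfl fun y _ => ?_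
    rw [MvPolynomial.X, binForm_mul]
    rfl
  obtain ⟨y, k⟩ := s
  have hpd : MvPolynomial.pderiv y.1 S = binForm v n N (c y) := by
    rw [hS2, map_sum, Finset.sum_eq_single y]
    · rw [Derivation.leibniz, binForm_pderiv]
      · simp
      · rintro h; have := y.2; rw [h] at this; simp at this
      · rintro h; have := y.2; rw [h] at this; omega
    · intro y' _ hy'
      rw [Derivation.leibniz, binForm_pderiv,
        MvPolynomial.pderiv_X_of_ne (fun h => hy' (Subtype.ext h))]
      · simp
      · rintro h; have := y.2; rw [h] at this; simp at this
      · rintro h; have := y.2; rw [h] at this; omega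
    · simp
  have h1 : MvPolynomial.aeval p (MvPolynomial.pderiv y.1 G) =
      MvPolynomial.aeval p (MvPolynomial.pderiv y.1 (G - S)) + shiftSum (c y) a := by
    rw [← binForm_aeval v n N (c y) p a hp0 hpv, ← hpd, ← map_add, ← map_add, sub_add_cancel]
  have h2 : MvPolynomial.aeval p (MvPolynomial.pderiv y.1 (G - S)) ∈ polyIn E :=
    aeval_mem_polyIn E _ (pderiv_coeff_mem E _ hdec _) p hp
  have h3 : shiftSum (c y) a ∈ polyIn E := by
    intro j
    by_cases hj : j < n
    · have := sub_mem (hT y.1 y.2 j hj) (h2 j)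
      rwa [h1, Polynomial.coeff_add, add_sub_cancel_left] at this
    · rw [shiftSum_natDegree _ _ _ (not_lt.1 hj)]; exact zero_mem _
  exact mem_of_shiftSum E (c y) ha h3 k

/-- special exponents, main case -/
noncomputable def sp1 {r : ℕ} (e : ℕ) (o y : Fin (r + 1)) (idx : Fin e → Fin (r + 1)) :
    Fin (e + 2) ⊕ (Fin e × Fin e) → (Fin (r + 1) →₀ ℕ)
  | Sum.inl k => Finsupp.single 0 (e + 1 - k) + Finsupp.single o (k : ℕ) + Finsupp.single y 1
  | Sum.inr s => Finsupp.single 0 (e - s.2) + Finsupp.single o (s.2 : ℕ) +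
      (Finsupp.single y 1 + Finsupp.single (idx s.1) 1)

theorem sp1_injective {r : ℕ} (e : ℕ) (o y : Fin (r + 1)) (idx : Fin e → Fin (r + 1))
    (ho : o ≠ 0) (hy0 : y ≠ 0) (hyo : y ≠ o) (hi0 : ∀ a, idx a ≠ 0) (hio : ∀ a, idx a ≠ o)
    (hidx : Function.Injective idx) :
    Function.Injective (sp1 e o y idx) := by
  rintro (k | ⟨a, k⟩) (k' | ⟨a', k'⟩) h
  all_goals
    have h1 := DFunLike.congr_fun h o
    simp only [sp1, Finsupp.add_apply, Finsupp.single_apply, ho.symm, hyo, hio] at h1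
    simp at h1
    have h2 := DFunLike.congr_fun h 0
    simp only [sp1, Finsupp.add_apply, Finsupp.single_apply, ho, hy0, hi0] at h2
    simp at h2
  · rw [Fin.ext h1]
  · exfalso; have := k.2; have := k'.2; omega
  · exfalso; have := k.2; have := k'.2; omega
  · have hk : k = k' := Fin.ext h1
    subst hk
    simp only [sp1, add_right_inj] at h
    have := hidx ((Finsupp.single_left_inj one_ne_zero).1 h)
    subst this
    rfl

theorem solve1 {K Ω : Type*} [Field K] [Field Ω] [Algebra K Ω] (E : IntermediateField K Ω)
    {r : ℕ} (e : ℕ) (he : 0 < e) (o y : Fin (r + 1)) (idx row : Fin e → Fin (r + 1))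
    (ho : o ≠ 0) (hy0 : y ≠ 0) (hyo : y ≠ o) (hi0 : ∀ a, idx a ≠ 0) (hio : ∀ a, idx a ≠ o)
    (hidx : Function.Injective idx)
    (hidx0 : idx ⟨0, he⟩ = y) (hrow0 : row ⟨0, he⟩ = o)
    (hrow : ∀ a, a ≠ ⟨0, he⟩ → row a = idx a) 
    (G : MvPolynomial (Fin (r + 1)) Ω)
    (hG : ∀ μ, μ ∉ Set.range (sp1 e o y idx) → G.coeff μ ∈ E)
    (p : Fin (r + 1) → Polynomial Ω) (hp : ∀ i, p i ∈ polyIn E) (a : Ω) (ha : a ∈ E)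
    (hp0 : p 0 = 1) (hpo : p o = Polynomial.C a + Polynomial.X)
    (w : Ω) (hw : w ∈ E) (hw0 : w ≠ 0) (hpy : p y = Polynomial.X * Polynomial.C w)
    (hf : MvPolynomial.aeval p G ∈ polyIn E)
    (hT : ∀ i : Fin e, ∀ k < e,
      (MvPolynomial.aeval p (MvPolynomial.pderiv (row i) G)).coeff (k + 1) ∈ E)
    (s) : G.coeff (sp1 e o y idx s) ∈ E := by
  classical
  have hdec := decomp_coeff_mem E G (sp1 e o y idx)
    (sp1_injective e o y idx ho hy0 hyo hi0 hio hidx) hG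
  set S := ∑ s, MvPolynomial.monomial (sp1 e o y idx s) (G.coeff (sp1 e o y idx s)) with hS
  set b : Fin (e + 2) → Ω := fun k => G.coeff (sp1 e o y idx (Sum.inl k)) with hb
  set c : Fin e → Fin e → Ω := fun i k => G.coeff (sp1 e o y idx (Sum.inr (i, k))) with hc
  have hS2 : S = (binForm o (e + 2) (e + 1) b +
      ∑ i, binForm o e e (c i) * MvPolynomial.X (idx i)) * MvPolynomial.X y := by
    rw [hS, Fintype.sum_sum_type, Fintype.sum_prod_type, add_mul, Finset.sum_mul]
    congr 1
    · rw [MvPolynomial.X, binForm_mul]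
      rfl
    · refine Finset.sum_congr rfl fun i _ => ?_
      rw [mul_assoc, MvPolynomial.X, MvPolynomial.X, MvPolynomial.monomial_mul, mul_one,
        binForm_mul, add_comm (Finsupp.single (idx i) 1)]
      rfl
  set ψ := shiftSum b a with hψ
  set φ : Fin e → Polynomial Ω := fun i => shiftSum (c i) a with hφ
  have haS : MvPolynomial.aeval p S =
      Polynomial.X * Polynomial.C w * (ψ + ∑ i, φ i * p (idx i)) := by
    rw [hS2]
    simp only [map_mul, map_add, map_sum, MvPolynomial.aeval_X, hpy,
      binForm_aeval o _ _ _ p a hp0 hpo]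
    ring
  have hbo : ∀ i n N (c : Fin n → Ω), i ≠ ⟨0, he⟩ →
      MvPolynomial.pderiv (row i) (binForm o n N c) = 0 := by
    intro i n N c hi
    rw [hrow i hi]
    exact binForm_pderiv _ _ _ _ _ (hi0 i) (hio i)
  have hyr : ∀ i, row i ≠ y := by
    intro i
    by_cases hi : i = ⟨0, he⟩
    · rw [hi, hrow0]; exact hyo.symm
    · rw [hrow i hi, ← hidx0]; exact fun h => hi (hidx h)
  have hrowS : ∀ i, i ≠ ⟨0, he⟩ → MvPolynomial.aeval p (MvPolynomial.pderiv (row i) S) =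
      Polynomial.X * Polynomial.C w * φ i := by
    intro i hi
    have : MvPolynomial.pderiv (row i) S = binForm o e e (c i) * MvPolynomial.X y := by
      rw [hS2, Derivation.leibniz, MvPolynomial.pderiv_X_of_ne (hyr i).symm, smul_zero, zero_add,
        map_add, hbo i _ _ _ hi,
        map_sum, Finset.sum_eq_single i]
      · rw [Derivation.leibniz, hbo i _ _ _ hi, hrow i hi]
        simp [mul_comm]
      · intro j _ hj
        rw [Derivation.leibniz, hbo i _ _ _ hi, hrow i hi,
          MvPolynomial.pderiv_X_of_ne (fun h => hj (hidx h))]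
        simp
      · simp
    rw [this, map_mul, MvPolynomial.aeval_X, binForm_aeval o _ _ _ p a hp0 hpo, hpy]
    ring
  have hrowo : MvPolynomial.aeval p (MvPolynomial.pderiv o S) =
      Polynomial.X * Polynomial.C w * (Polynomial.derivative ψ +
        ∑ i, Polynomial.derivative (φ i) * p (idx i)) := by
    rw [hS2, Derivation.leibniz, MvPolynomial.pderiv_X_of_ne hyo, smul_zero, zero_add,
      (MvPolynomial.pderiv o).map_add, map_sum (MvPolynomial.pderiv o)]
    have : ∀ i, MvPolynomial.pderiv o (binForm o e e (c i) * MvPolynomial.X (idx i)) =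
      MvPolynomial.pderiv o (binForm o e e (c i)) * MvPolynomial.X (idx i) := by
      intro i
      rw [Derivation.leibniz, MvPolynomial.pderiv_X_of_ne (hio i)]
      simp [mul_comm]
    simp only [this, map_mul, map_add, map_sum, MvPolynomial.aeval_X, hpy, smul_zero, zero_add,
      smul_eq_mul, binForm_aeval_pderiv o _ _ _ p a hp0 hpo]
    rfl
  have hsplit : ∀ i, MvPolynomial.aeval p (MvPolynomial.pderiv i G) =
      MvPolynomial.aeval p (MvPolynomial.pderiv i (G - S)) +
      MvPolynomial.aeval p (MvPolynomial.pderiv i S) := by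
    intro i; rw [← map_add, ← map_add, sub_add_cancel]
  have hmem : ∀ i, MvPolynomial.aeval p (MvPolynomial.pderiv i (G - S)) ∈ polyIn E := fun i =>
    aeval_mem_polyIn E _ (pderiv_coeff_mem E _ hdec _) p hp
  have hTS : ∀ i : Fin e, ∀ k < e,
      (MvPolynomial.aeval p (MvPolynomial.pderiv (row i) S)).coeff (k + 1) ∈ E := by
    intro i k hk
    have := sub_mem (hT i k hk) (hmem (row i) (k + 1))
    rwa [hsplit, Polynomial.coeff_add, add_sub_cancel_left] at this
  have hcan : ∀ P : Polynomial Ω, ∀ k,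
      (Polynomial.X * Polynomial.C w * P).coeff (k + 1) = w * P.coeff k := by
    intro P k
    rw [mul_assoc, Polynomial.coeff_X_mul, Polynomial.coeff_C_mul]
  have hφi : ∀ i, i ≠ ⟨0, he⟩ → φ i ∈ polyIn E := by
    intro i hi k
    by_cases hk : k < e
    · have := hTS i k hk
      rw [hrowS i hi, hcan] at this
      have := mul_mem (inv_mem hw) this
      rwa [inv_mul_cancel_left₀ hw0] at this
    · rw [hφ]; dsimp only
      rw [shiftSum_natDegree _ _ _ (not_lt.1 hk)]; exact zero_mem _
  have hSf : ψ + ∑ i, φ i * p (idx i) ∈ polyIn E := by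
    apply cancel_polyIn E hw hw0
    rw [← haS]
    have : MvPolynomial.aeval p S = MvPolynomial.aeval p G - MvPolynomial.aeval p (G - S) := by
      rw [← map_sub, sub_sub_cancel]
    rw [this]
    exact sub_mem hf (aeval_mem_polyIn E _ hdec p hp)
  have hsum : ∀ f : Fin e → Polynomial Ω, ∑ i, f i * p (idx i) =
      f ⟨0, he⟩ * p y + ∑ i ∈ Finset.univ.erase ⟨0, he⟩, f i * p (idx i) := by
    intro f
    rw [← Finset.add_sum_erase _ _ (Finset.mem_univ (⟨0, he⟩ : Fin e)), hidx0]
  rw [hsum] at hSf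
  have hR : ∑ i ∈ Finset.univ.erase ⟨0, he⟩, φ i * p (idx i) ∈ polyIn E :=
    sum_mem fun i hi => mul_mem (hφi i (Finset.ne_of_mem_erase hi)) (hp _)
  have hR' : ∑ i ∈ Finset.univ.erase ⟨0, he⟩, Polynomial.derivative (φ i) * p (idx i) ∈ polyIn E :=
    sum_mem fun i hi => mul_mem (derivative_mem_polyIn E (hφi i (Finset.ne_of_mem_erase hi))) (hp _)
  have hS1 : ψ + φ ⟨0, he⟩ * p y ∈ polyIn E := by
    have := sub_mem hSf hR
    rwa [← add_assoc, add_sub_cancel_right] at this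
  have hS1' := derivative_mem_polyIn E hS1
  have hφ0 : φ ⟨0, he⟩ ∈ polyIn E := by
    intro k
    by_cases hk : k < e
    · have h1 := hTS ⟨0, he⟩ k hk
      rw [hrow0, hrowo, hcan] at h1
      have h1 := mul_mem (inv_mem hw) h1
      rw [inv_mul_cancel_left₀ hw0, hsum] at h1
      have h2 : Polynomial.derivative ψ + (Polynomial.derivative (φ ⟨0, he⟩) * p y +
          ∑ i ∈ Finset.univ.erase ⟨0, he⟩, Polynomial.derivative (φ i) * p (idx i)) =
          Polynomial.derivative (ψ + φ ⟨0, he⟩ * p y) +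
          ∑ i ∈ Finset.univ.erase ⟨0, he⟩, Polynomial.derivative (φ i) * p (idx i) -
          Polynomial.C w * φ ⟨0, he⟩ := by
        rw [hpy]
        simp only [Polynomial.derivative_add, Polynomial.derivative_mul, Polynomial.derivative_X,
          Polynomial.derivative_C]
        ring
      rw [h2, Polynomial.coeff_sub, Polynomial.coeff_C_mul] at h1
      have h3 := sub_mem (add_mem hS1' hR' k) h1
      rw [sub_sub_cancel] at h3
      have := mul_mem (inv_mem hw) h3
      rwa [inv_mul_cancel_left₀ hw0] at this
    · rw [hφ]; dsimp only
      rw [shiftSum_natDegree _ _ _ (not_lt.1 hk)]; exact zero_mem _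
  have hψm : ψ ∈ polyIn E := by
    have := sub_mem hS1 (mul_mem hφ0 (hp y))
    rwa [add_sub_cancel_right] at this
  rcases s with k | ⟨i, k⟩
  · exact mem_of_shiftSum E b ha hψm k
  · by_cases hi : i = ⟨0, he⟩
    · subst hi
      exact mem_of_shiftSum E (c _) ha hφ0 k
    · exact mem_of_shiftSum E (c i) ha (hφi i hi) k

theorem det_ne_zero_of_algInd {K Ω ι : Type*} [Field K] [Field Ω] [Algebra K Ω] [Fintype ι]
    [DecidableEq ι] (T : ι → ι → Ω)
    (hT : AlgebraicIndependent K (fun s : ι × ι => T s.1 s.2)) : (Matrix.of T).det ≠ 0 := by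
  have h := Matrix.det_mvPolynomialX_ne_zero ι K
  have h2 : MvPolynomial.aeval (fun s : ι × ι => T s.1 s.2) (Matrix.mvPolynomialX ι ι K).det =
      (Matrix.of T).det := by
    rw [AlgHom.map_det]
    congr 1
    ext i j
    simp [Matrix.mvPolynomialX]
  rw [← h2]
  intro h3
  exact h ((injective_iff_map_eq_zero _).1 hT _ h3)

/-- the exponents that occur in `G` -/
abbrev Mon (q r D : ℕ) := {μ : Fin (r + 1) →₀ ℕ //
        (∑ i, μ i) = D ∧ ∃ i : Fin (r + 1), q < (i : ℕ) ∧ μ i ≠ 0}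

instance Mon_finite (q r D : ℕ) : Finite (Mon q r D) := by
  classical
  have : {μ : Fin (r + 1) →₀ ℕ | (∑ i, μ i) = D ∧ ∃ i : Fin (r + 1), q < (i : ℕ) ∧ μ i ≠ 0}.Finite := by
    refine (Finset.finite_toSet (Finset.finsuppAntidiag Finset.univ D)).subset ?_
    intro μ hμ
    simp only [Finset.mem_coe, Finset.mem_finsuppAntidiag]
    exact ⟨hμ.1, Finset.subset_univ _⟩
  exact this.to_subtype

noncomputable instance Mon_fintype (q r D : ℕ) : Fintype (Mon q r D) := Fintype.ofFinite _

theorem card_not_range {S M : Type*} [Fintype S] [Fintype M] (m : S → M)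
    (hm : Function.Injective m) [Fintype {x : M // x ∉ Set.range m}] :
    Fintype.card {x : M // x ∉ Set.range m} + Fintype.card S = Fintype.card M := by
  classical
  have h := Fintype.card_compl_set (Set.range m)
  have h2 := Set.card_range_of_injective hm
  have h3 : Fintype.card S ≤ Fintype.card M := Fintype.card_le_of_injective m hm
  have h4 : Fintype.card {x : M // x ∉ Set.range m} = Fintype.card ((Set.range m)ᶜ : Set M) :=
    Fintype.card_congr (Equiv.refl _)
  rw [h4, h, h2]
  omega

theorem coeff_eq_zero_of_not_mon {Ω : Type*} [Field Ω] {q r D : ℕ}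
    (G : MvPolynomial (Fin (r + 1)) Ω) (hG : G.IsHomogeneous D)
    (hY : ∀ μ ∈ G.support, ∃ i : Fin (r + 1), q < (i : ℕ) ∧ μ i ≠ 0) (μ : Fin (r + 1) →₀ ℕ)
    (hμ : ¬ ((∑ i, μ i) = D ∧ ∃ i : Fin (r + 1), q < (i : ℕ) ∧ μ i ≠ 0)) : G.coeff μ = 0 := by
  by_contra h
  refine hμ ⟨?_, hY μ (MvPolynomial.mem_support_iff.2 h)⟩
  have := hG h
  rw [← this, Finsupp.weight_apply, Finsupp.sum_fintype] <;> simp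

theorem sum_single_univ {r : ℕ} (a : Fin (r + 1)) (n : ℕ) : ∑ i, Finsupp.single a n i = n := by
  simp [Finsupp.single_apply]

theorem sp1_mon {q r : ℕ} (e D : ℕ) (hD : D = e + 2) (o y : Fin (r + 1)) (hyq : q < (y : ℕ))
    (idx : Fin e → Fin (r + 1)) (s) :
    (∑ i, sp1 e o y idx s i) = D ∧ ∃ i : Fin (r + 1), q < (i : ℕ) ∧ sp1 e o y idx s i ≠ 0 := by
  refine ⟨?_, y, hyq, ?_⟩
  · rcases s with k | ⟨a, k⟩
    · have := k.2
      simp only [sp1, Finsupp.add_apply, Finset.sum_add_distrib, sum_single_univ]; omega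
    · have := k.2
      simp only [sp1, Finsupp.add_apply, Finset.sum_add_distrib, sum_single_univ]; omega
  · rcases s with k | ⟨a, k⟩ <;> simp [sp1]

theorem sp0_mon {q r : ℕ} (v : Fin (r + 1)) (n N : ℕ) (hn : n ≤ N + 1) (s) :
    (∑ i, sp0 (q := q) v n N s i) = N + 1 ∧
      ∃ i : Fin (r + 1), q < (i : ℕ) ∧ sp0 (q := q) v n N s i ≠ 0 := by
  refine ⟨?_, s.1.1, s.1.2, ?_⟩
  · have := s.2.2
    simp only [sp0, Finsupp.add_apply, Finset.sum_add_distrib, sum_single_univ]; omega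
  · simp [sp0]

theorem main_ind {K Ω : Type*} [Field K] [Field Ω] [Algebra K Ω] {q r e D : ℕ}
    (he : 2 ≤ e) (heq : e ≤ q) (hqr : q < r) (her : e + 1 ≤ r) (hD : D = e + 2)
    (G : MvPolynomial (Fin (r + 1)) Ω)
    (hGz : ∀ μ : Fin (r + 1) →₀ ℕ,
      ¬ ((∑ i, μ i) = D ∧ ∃ i : Fin (r + 1), q < (i : ℕ) ∧ μ i ≠ 0) → G.coeff μ = 0)
    (η ξ : Fin (r + 1) → Ω) (hη0 : η 0 = 1) (hηz : ∀ i : Fin (r + 1), e < (i : ℕ) → η i = 0)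
    (hξ0 : ξ 0 = 0) (hξ1 : ξ ⟨1, by omega⟩ = 1) (m : ℕ) (hm : m + e = r - 1) (v : Fin m → Ω)
    (hx : AlgebraicIndependent K (Sum.elim (fun μ : Mon q r D => G.coeff μ.1)
      (Sum.elim (fun j : Fin e => η ⟨(j : ℕ) + 1, by have := j.isLt; omega⟩) v)))
    (hv : ∀ E : IntermediateField K Ω, (∀ μ, G.coeff μ ∈ E) → (∀ i, η i ∈ E) → (∀ i, ξ i ∈ E) →
      ∀ i, v i ∈ E)
    (y : Fin (r + 1)) (hyq : q < (y : ℕ)) (hy : ξ y ≠ 0)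
    (hf : ∀ k, k ≠ e + 1 → k ≠ e + 2 → (MvPolynomial.aeval (fun i : Fin (r + 1) =>
          Polynomial.C (η i) + Polynomial.X * Polynomial.C (ξ i)) G).coeff k = 0) :
    (MvPolynomial.aeval (fun i : Fin (r + 1) =>
          Polynomial.C (η i) + Polynomial.X * Polynomial.C (ξ i)) G).coeff (e + 1) ≠ 0 ∧
    (MvPolynomial.aeval (fun i : Fin (r + 1) =>
          Polynomial.C (η i) + Polynomial.X * Polynomial.C (ξ i)) G).coeff (e + 2) ≠ 0 ∧
    (Matrix.of (fun i k : Fin e => ((MvPolynomial.aeval (fun i : Fin (r + 1) =>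
          Polynomial.C (η i) + Polynomial.X * Polynomial.C (ξ i))
        (MvPolynomial.pderiv (⟨(i : ℕ) + 1, by have := i.isLt; omega⟩ : Fin (r + 1)) G)).coeff ((k : ℕ) + 1) : Ω))).det ≠ 0 := by
  classical
  set p : Fin (r + 1) → Polynomial Ω := fun i : Fin (r + 1) =>
          Polynomial.C (η i) + Polynomial.X * Polynomial.C (ξ i) with hp
  set o : Fin (r + 1) := ⟨1, by omega⟩ with ho
  set row : Fin e → Fin (r + 1) := fun i => ⟨(i : ℕ) + 1, by have := i.isLt; omega⟩ with hrow
  set idx : Fin e → Fin (r + 1) := fun i => if (i : ℕ) = 0 then y else row i with hidx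
  have ho0 : o ≠ 0 := by rw [ho]; intro h; simpa using congrArg Fin.val h
  have hy0 : y ≠ 0 := by rintro rfl; simp at hyq
  have hyo : y ≠ o := by rintro h; rw [h, ho] at hyq; simp at hyq; omega
  have hi0 : ∀ a, idx a ≠ 0 := by
    intro a
    by_cases ha : (a : ℕ) = 0
    · simp only [hidx, ha, if_true]; exact hy0
    · simp only [hidx, ha, if_false, hrow]; intro h; simpa using congrArg Fin.val h
  have hio : ∀ a, idx a ≠ o := by
    intro a
    by_cases ha : (a : ℕ) = 0
    · simp only [hidx, ha, if_true]; exact hyo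
    · simp only [hidx, ha, if_false, hrow, ho]; intro h; have := congrArg Fin.val h; simp at this; omega
  have hinj : Function.Injective idx := by
    intro a b hab
    have hav := congrArg Fin.val hab
    have := a.2
    have := b.2
    simp only [hidx, hrow] at hav
    split_ifs at hav with h1 h2 h2
    · exact Fin.ext (h1.trans h2.symm)
    · simp at hav; omega
    · simp at hav; omega
    · simp at hav; exact Fin.ext hav
  have e0 : 0 < e := by omega
  set SP := sp1 e o y idx with hSP
  have hSPinj : Function.Injective SP := sp1_injective e o y idx ho0 hy0 hyo hi0 hio hinj
  set sM : Fin (e + 2) ⊕ (Fin e × Fin e) → Mon q r D := fun s =>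
    ⟨SP s, sp1_mon e D hD o y hyq idx s⟩ with hsM
  have hsMinj : Function.Injective sM := fun a b h => hSPinj (congrArg Subtype.val h)
  set T : Fin e → Fin e → Ω := fun i k =>
    (MvPolynomial.aeval p (MvPolynomial.pderiv (row i) G)).coeff ((k : ℕ) + 1) with hT
  set AB : Fin 2 → Ω := fun i => (MvPolynomial.aeval p G).coeff (e + 1 + i) with hAB
  set fam : {μ : Mon q r D // μ ∉ Set.range sM} ⊕ (Fin e ⊕ (Fin (r - 1) ⊕ (Fin 2 ⊕ Fin e × Fin e))) → Ω :=
    Sum.elim (fun μ => G.coeff μ.1.1) (Sum.elim (fun j => η (row j))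
      (Sum.elim (fun i : Fin (r - 1) => ξ ⟨(i : ℕ) + 2, by have := i.isLt; omega⟩)
        (Sum.elim AB fun s => T s.1 s.2))) with hfam
  have hind : AlgebraicIndependent K fam := by
    set E := IntermediateField.adjoin K (Set.range fam) with hE
    have hmem : ∀ i, fam i ∈ E := fun i => IntermediateField.subset_adjoin _ _ ⟨i, rfl⟩
    have hηE : ∀ i, η i ∈ E := by
      intro i
      by_cases hi0 : (i : ℕ) = 0
      · have : i = 0 := Fin.ext hi0
        rw [this, hη0]; exact one_mem _
      by_cases hi : e < (i : ℕ)
      · rw [hηz i hi]; exact zero_mem _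
      · have := hmem (Sum.inr (Sum.inl ⟨(i : ℕ) - 1, by omega⟩))
        simp only [hfam, Sum.elim_inr, Sum.elim_inl, hrow] at this
        convert this
        omega
    have hξE : ∀ i, ξ i ∈ E := by
      intro i
      by_cases hi0 : (i : ℕ) = 0
      · have : i = 0 := Fin.ext hi0
        rw [this, hξ0]; exact zero_mem _
      by_cases hi1 : (i : ℕ) = 1
      · have : i = o := Fin.ext hi1
        rw [this, hξ1]; exact one_mem _
      · have := hmem (Sum.inr (Sum.inr (Sum.inl ⟨(i : ℕ) - 2, by have := i.2; omega⟩)))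
        simp only [hfam, Sum.elim_inr, Sum.elim_inl, hrow] at this
        convert this
        omega
    have hpE : ∀ i, p i ∈ polyIn E := fun i =>
      add_mem (C_mem_polyIn E (hηE i)) (mul_mem (X_mem_polyIn E) (C_mem_polyIn E (hξE i)))
    have hns : ∀ μ, μ ∉ Set.range SP → G.coeff μ ∈ E := by
      intro μ hμ
      by_cases hμ1 : ((∑ i, μ i) = D ∧ ∃ i : Fin (r + 1), q < (i : ℕ) ∧ μ i ≠ 0)
      · have h1 : (⟨μ, hμ1⟩ : Mon q r D) ∉ Set.range sM := by
          rintro ⟨s, hs⟩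
          exact hμ ⟨s, congrArg Subtype.val hs⟩
        exact hmem (Sum.inl ⟨⟨μ, hμ1⟩, h1⟩)
      · rw [hGz μ hμ1]; exact zero_mem _
    have hfE : MvPolynomial.aeval p G ∈ polyIn E := by
      intro k
      by_cases hk1 : k = e + 1
      · rw [hk1]; exact hmem (Sum.inr (Sum.inr (Sum.inr (Sum.inl 0))))
      by_cases hk2 : k = e + 2
      · rw [hk2]; exact hmem (Sum.inr (Sum.inr (Sum.inr (Sum.inl 1))))
      rw [hf k hk1 hk2]; exact zero_mem _
    have hsp : ∀ s, G.coeff (SP s) ∈ E := by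
      refine solve1 E e e0 o y idx row ho0 hy0 hyo hi0 hio hinj (by simp [hidx]) (by simp [hrow, ho])
        ?_ G hns p hpE (η o) (hηE o) ?_ ?_ (ξ y) (hξE y) hy ?_ hfE ?_
      · intro a ha
        have : (a : ℕ) ≠ 0 := fun h => ha (Fin.ext h)
        simp [hidx, this]
      · simp [hp, hη0, hξ0]
      · simp [hp, hξ1]
      · simp [hp, hηz y (by omega)]
      · intro i k hk
        exact hmem (Sum.inr (Sum.inr (Sum.inr (Sum.inr (i, ⟨k, hk⟩)))))
    have hbE : ∀ μ, G.coeff μ ∈ E := by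
      intro μ
      by_cases hμ : μ ∈ Set.range SP
      · obtain ⟨s, rfl⟩ := hμ; exact hsp s
      · exact hns μ hμ
    refine algInd_of_card _ fam hx ?_ ?_
    · have h1 := card_not_range sM hsMinj
      simp only [Fintype.card_sum, Fintype.card_prod, Fintype.card_fin] at h1 ⊢
      omega
    · have key : ∀ a ∈ E, IsAlgebraic E a := fun a ha =>
        isAlgebraic_algebraMap (⟨a, ha⟩ : E)
      rintro (μ | j | i)
      · exact key _ (hbE _)
      · exact key _ (hηE _)
      · exact key _ (hv E hbE hηE hξE i)
  refine ⟨hind.ne_zero (Sum.inr (Sum.inr (Sum.inr (Sum.inl 0)))),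
    hind.ne_zero (Sum.inr (Sum.inr (Sum.inr (Sum.inl 1)))), ?_⟩
  have hTind : AlgebraicIndependent K (fun s : Fin e × Fin e => T s.1 s.2) :=
    hind.comp (fun s => Sum.inr (Sum.inr (Sum.inr (Sum.inr s)))) (fun a b h => by simpa using h)
  exact det_ne_zero_of_algInd T hTind

theorem card_le_of_algInd {K Ω : Type*} [Field K] [Field Ω] [Algebra K Ω] {ι κ : Type*}
    [Fintype ι] [Fintype κ] (x : ι → Ω) (y : κ → Ω) (hx : AlgebraicIndependent K x)
    (halg : ∀ i, IsAlgebraic (IntermediateField.adjoin K (Set.range y)) (x i)) :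
    Fintype.card ι ≤ Fintype.card κ := by
  by_contra! h
  have hr : IntermediateField.adjoin K (Set.range y) ≤
      IntermediateField.adjoin K (Set.range (Sum.elim y (fun _ : Unit => (0 : Ω)))) := by
    apply IntermediateField.adjoin.mono
    rintro _ ⟨i, rfl⟩
    exact ⟨Sum.inl i, rfl⟩
  have := algInd_of_card x (Sum.elim y (fun _ : Unit => (0 : Ω))) hx
    (by simp only [Fintype.card_sum, Fintype.card_unit]; omega) (fun i => by
      let := (IntermediateField.inclusion hr).toRingHom.toAlgebra
      have : IsScalarTower (IntermediateField.adjoin K (Set.range y))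
        (IntermediateField.adjoin K (Set.range (Sum.elim y (fun _ : Unit => (0 : Ω))))) Ω :=
        IsScalarTower.of_algebraMap_eq fun _ => rfl
      exact (halg i).extendScalars (FaithfulSMul.algebraMap_injective _ _))
  exact this.ne_zero (Sum.inr ()) rfl

theorem aeval_zero_of_Y {Ω A : Type*} [Field Ω] [CommRing A] [Algebra Ω A] {q r : ℕ}
    (G : MvPolynomial (Fin (r + 1)) Ω)
    (hY : ∀ μ ∈ G.support, ∃ i : Fin (r + 1), q < (i : ℕ) ∧ μ i ≠ 0)
    (p : Fin (r + 1) → A) (hp : ∀ i : Fin (r + 1), q < (i : ℕ) → p i = 0) :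
    MvPolynomial.aeval p G = 0 := by
  rw [MvPolynomial.aeval_def, MvPolynomial.eval₂_eq']
  refine Finset.sum_eq_zero fun μ hμ => ?_
  obtain ⟨i, hi, hμi⟩ := hY μ hμ
  rw [Finset.prod_eq_zero (Finset.mem_univ i), mul_zero]
  rw [hp i hi, zero_pow hμi]

theorem aeval_delta {L Ω A : Type*} [Field L] [Field Ω] [Algebra L Ω]
    [CommRing A] [Algebra Ω A] [Algebra L A] [IsScalarTower L Ω A] {r : ℕ}
    (P : MvPolynomial (Fin (r + 1)) Ω) (δ : MvPolynomial (Fin (r - 1)) L)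
    (hδ : MvPolynomial.map (algebraMap L Ω) δ
      = MvPolynomial.aeval (fun i : Fin (r + 1) =>
          if _h1 : (i : ℕ) = 0 then 0
          else if _h2 : (i : ℕ) = 1 then 1
          else MvPolynomial.X (⟨(i : ℕ) - 2, by have := i.isLt; omega⟩ : Fin (r - 1))) P)
    (z : Fin (r - 1) → A) :
    MvPolynomial.aeval z δ = MvPolynomial.aeval (fun i : Fin (r + 1) =>
          if _h1 : (i : ℕ) = 0 then 0
          else if _h2 : (i : ℕ) = 1 then 1
          else z (⟨(i : ℕ) - 2, by have := i.isLt; omega⟩ : Fin (r - 1))) P := by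
  rw [← MvPolynomial.aeval_map_algebraMap Ω z δ, hδ, ← AlgHom.comp_apply, MvPolynomial.comp_aeval]
  congr 2
  funext i
  split_ifs <;> simp

theorem lead_coeff {Ω : Type*} [Field Ω] {n : ℕ} (Q : MvPolynomial (Fin n) Ω)
    (c a b : Fin n → Ω) (k : ℕ) :
    ((MvPolynomial.aeval (fun i => Polynomial.C (Polynomial.C (c i)) + Polynomial.X *
      Polynomial.C (Polynomial.C (a i) + Polynomial.X * Polynomial.C (b i))) Q).coeff k).natDegree ≤ k ∧
    ((MvPolynomial.aeval (fun i => Polynomial.C (Polynomial.C (c i)) + Polynomial.X *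
      Polynomial.C (Polynomial.C (a i) + Polynomial.X * Polynomial.C (b i))) Q).coeff k).coeff k =
    (MvPolynomial.aeval (fun i => Polynomial.C (c i) + Polynomial.X * Polynomial.C (b i)) Q).coeff k := by
  revert k
  have hmul : ∀ (f g : Polynomial (Polynomial Ω)) (f' g' : Polynomial Ω),
      (∀ k, (f.coeff k).natDegree ≤ k ∧ (f.coeff k).coeff k = f'.coeff k) →
      (∀ k, (g.coeff k).natDegree ≤ k ∧ (g.coeff k).coeff k = g'.coeff k) →
      (∀ k, ((f * g).coeff k).natDegree ≤ k ∧ ((f * g).coeff k).coeff k = (f' * g').coeff k) := by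
    intro f g f' g' hf hg k
    rw [Polynomial.coeff_mul, Polynomial.coeff_mul, Polynomial.finsetSum_coeff]
    refine ⟨Polynomial.natDegree_sum_le_of_forall_le _ _ fun x hx => ?_,
      Finset.sum_congr rfl fun x hx => ?_⟩
    · rw [← Finset.HasAntidiagonal.mem_antidiagonal.1 hx]
      exact Polynomial.natDegree_mul_le_of_le (hf _).1 (hg _).1
    · rw [← (hf _).2, ← (hg _).2, ← Finset.HasAntidiagonal.mem_antidiagonal.1 hx]
      exact Polynomial.coeff_mul_add_eq_of_natDegree_le (hf _).1 (hg _).1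
  induction Q using MvPolynomial.induction_on with
  | C t =>
    intro k
    rw [MvPolynomial.algHom_C, MvPolynomial.algHom_C]
    change ((Polynomial.C (Polynomial.C t)).coeff k).natDegree ≤ k ∧
      ((Polynomial.C (Polynomial.C t)).coeff k).coeff k = (Polynomial.C t).coeff k
    by_cases hk : k = 0
    · subst hk; simp
    · simp [Polynomial.coeff_C, hk]
  | add p q hp hq =>
    intro k
    rw [map_add, map_add, Polynomial.coeff_add, Polynomial.coeff_add, Polynomial.coeff_add,
      (hp k).2, (hq k).2]
    exact ⟨Polynomial.natDegree_add_le_of_degree_le (hp k).1 (hq k).1, rfl⟩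
  | mul_X p i hp =>
    rw [map_mul, map_mul]
    refine hmul _ _ _ _ hp ?_
    intro k
    rw [MvPolynomial.aeval_X, MvPolynomial.aeval_X]
    rcases k with _ | _ | k
    · simp
    · simp only [Polynomial.coeff_add, Polynomial.coeff_X_mul, zero_add, Polynomial.coeff_C_ne_zero one_ne_zero,
        Polynomial.coeff_C_zero]
      refine ⟨?_, ?_⟩
      · compute_degree
      · simp [Polynomial.coeff_C]
    · simp [Polynomial.coeff_C]

theorem coeff_prod_nonunif {Ω ι : Type*} [Field Ω] (s : Finset ι) (f : ι → Polynomial Ω)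
    (n : ι → ℕ) (h : ∀ i, (f i).natDegree ≤ n i) :
    (∏ i ∈ s, f i).natDegree ≤ ∑ i ∈ s, n i ∧
    (∏ i ∈ s, f i).coeff (∑ i ∈ s, n i) = ∏ i ∈ s, (f i).coeff (n i) := by
  classical
  induction s using Finset.induction_on with
  | empty => simp
  | insert a s ha ih =>
    rw [Finset.prod_insert ha, Finset.sum_insert ha, Finset.prod_insert ha]
    exact ⟨Polynomial.natDegree_mul_le_of_le (h a) ih.1, by
      rw [Polynomial.coeff_mul_add_eq_of_natDegree_le (h a) ih.1, ih.2]⟩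

theorem coeff_det_nonunif {Ω ι : Type*} [Field Ω] [Fintype ι] [DecidableEq ι]
    (M : Matrix ι ι (Polynomial Ω)) (n : ι → ℕ) (h : ∀ i j, (M i j).natDegree ≤ n i) :
    M.det.coeff (∑ i, n i) = (Matrix.of fun i j => (M i j).coeff (n i)).det := by
  rw [Matrix.det_apply, Matrix.det_apply, Polynomial.finsetSum_coeff]
  refine Finset.sum_congr rfl fun σ _ => ?_
  have h1 := (coeff_prod_nonunif Finset.univ (fun i => M (σ i) i) (fun i => n (σ i))
    (fun i => h _ _)).2
  rw [Equiv.sum_comp σ n] at h1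
  simp only [Matrix.of_apply]
  rw [← h1]
  rcases Int.units_eq_one_or (Equiv.Perm.sign σ) with hs | hs <;> simp [hs]

theorem T0_ind {K Ω : Type*} [Field K] [Field Ω] [Algebra K Ω] {q r e D : ℕ}
    (he : 2 ≤ e) (heq : e ≤ q) (her : e + 1 ≤ r) (hD : D = e + 2)
    (G : MvPolynomial (Fin (r + 1)) Ω)
    (hGz : ∀ μ : Fin (r + 1) →₀ ℕ,
      ¬ ((∑ i, μ i) = D ∧ ∃ i : Fin (r + 1), q < (i : ℕ) ∧ μ i ≠ 0) → G.coeff μ = 0)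
    (η : Fin (r + 1) → Ω) (hη0 : η 0 = 1) (hηz : ∀ i : Fin (r + 1), e < (i : ℕ) → η i = 0)
    (hx : AlgebraicIndependent K (Sum.elim (fun μ : Mon q r D => G.coeff μ.1)
      (fun j : Fin e => η ⟨(j : ℕ) + 1, by have := j.isLt; omega⟩))) :
    AlgebraicIndependent K (fun s : {i : Fin (r + 1) // q < (i : ℕ)} × Fin e =>
      (MvPolynomial.aeval (fun i : Fin (r + 1) => Polynomial.C (η i) + Polynomial.X *
        Polynomial.C (if (i : ℕ) = 2 then 1 else 0)) (MvPolynomial.pderiv s.1.1 G)).coeff (s.2 : ℕ)) := by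
  classical
  set p : Fin (r + 1) → Polynomial Ω := fun i : Fin (r + 1) => Polynomial.C (η i) + Polynomial.X *
        Polynomial.C (if (i : ℕ) = 2 then 1 else 0) with hp
  set v : Fin (r + 1) := ⟨2, by omega⟩ with hv
  have hv0 : v ≠ 0 := by rw [hv]; intro h; simpa using congrArg Fin.val h
  have hvq : (v : ℕ) ≤ q := by simp only [hv]; omega
  set SP := sp0 (q := q) v e (e + 1) with hSP
  have hSPinj : Function.Injective SP := sp0_injective v e (e + 1) hv0 hvq
  set sM : {i : Fin (r + 1) // q < (i : ℕ)} × Fin e → Mon q r D := fun s =>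
    ⟨SP s, by rw [hD]; exact sp0_mon v e (e + 1) (by omega) s⟩ with hsM
  have hsMinj : Function.Injective sM := fun a b h => hSPinj (congrArg Subtype.val h)
  set T : {i : Fin (r + 1) // q < (i : ℕ)} × Fin e → Ω := fun s =>
    (MvPolynomial.aeval p (MvPolynomial.pderiv s.1.1 G)).coeff (s.2 : ℕ) with hT
  set fam : {μ : Mon q r D // μ ∉ Set.range sM} ⊕ (Fin e ⊕
      {i : Fin (r + 1) // q < (i : ℕ)} × Fin e) → Ω :=
    Sum.elim (fun μ => G.coeff μ.1.1) (Sum.elim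
      (fun j => η ⟨(j : ℕ) + 1, by have := j.isLt; omega⟩) T) with hfam
  have hind : AlgebraicIndependent K fam := by
    set E := IntermediateField.adjoin K (Set.range fam) with hE
    have hmem : ∀ i, fam i ∈ E := fun i => IntermediateField.subset_adjoin _ _ ⟨i, rfl⟩
    have hηE : ∀ i, η i ∈ E := by
      intro i
      by_cases hi0 : (i : ℕ) = 0
      · have : i = 0 := Fin.ext hi0
        rw [this, hη0]; exact one_mem _
      by_cases hi : e < (i : ℕ)
      · rw [hηz i hi]; exact zero_mem _
      · have := hmem (Sum.inr (Sum.inl ⟨(i : ℕ) - 1, by omega⟩))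
        simp only [hfam, Sum.elim_inr, Sum.elim_inl] at this
        convert this
        omega
    have hpE : ∀ i, p i ∈ polyIn E := fun i =>
      add_mem (C_mem_polyIn E (hηE i)) (mul_mem (X_mem_polyIn E) (C_mem_polyIn E (by
        split_ifs; exacts [one_mem _, zero_mem _])))
    have hns : ∀ μ, μ ∉ Set.range SP → G.coeff μ ∈ E := by
      intro μ hμ
      by_cases hμ1 : ((∑ i, μ i) = D ∧ ∃ i : Fin (r + 1), q < (i : ℕ) ∧ μ i ≠ 0)
      · have h1 : (⟨μ, hμ1⟩ : Mon q r D) ∉ Set.range sM := by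
          rintro ⟨s, hs⟩
          exact hμ ⟨s, congrArg Subtype.val hs⟩
        exact hmem (Sum.inl ⟨⟨μ, hμ1⟩, h1⟩)
      · rw [hGz μ hμ1]; exact zero_mem _
    have hsp : ∀ s, G.coeff (SP s) ∈ E := by
      refine solve0 E v e (e + 1) hv0 hvq G hns p hpE (η v) (hηE v) ?_ ?_ ?_
      · simp [hp, hη0]
      · simp [hp, hv]
      · intro i hi k hk
        exact hmem (Sum.inr (Sum.inr (⟨i, hi⟩, ⟨k, hk⟩)))
    have hbE : ∀ μ, G.coeff μ ∈ E := by
      intro μ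
      by_cases hμ : μ ∈ Set.range SP
      · obtain ⟨s, rfl⟩ := hμ; exact hsp s
      · exact hns μ hμ
    refine algInd_of_card _ fam hx ?_ ?_
    · have h1 := card_not_range sM hsMinj
      simp only [Fintype.card_sum, Fintype.card_prod, Fintype.card_fin] at h1 ⊢
      omega
    · have key : ∀ a ∈ E, IsAlgebraic E a := fun a ha =>
        isAlgebraic_algebraMap (⟨a, ha⟩ : E)
      rintro (μ | j)
      · exact key _ (hbE _)
      · exact key _ (hηE _)
  exact hind.comp (fun s => Sum.inr (Sum.inr s)) (fun a b h => by simpa using h)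

theorem delta_pderiv {L Ω A : Type*} [Field L] [Field Ω] [Algebra L Ω]
    [CommRing A] [Algebra Ω A] [Algebra L A] [IsScalarTower L Ω A] {r : ℕ}
    (G : MvPolynomial (Fin (r + 1)) Ω) (η : Fin (r + 1) → Ω) (k : ℕ)
    (δ : MvPolynomial (Fin (r - 1)) L)
    (hδ : MvPolynomial.map (algebraMap L Ω) δ
      = MvPolynomial.aeval (fun i : Fin (r + 1) =>
          if _h1 : (i : ℕ) = 0 then 0
          else if _h2 : (i : ℕ) = 1 then 1
          else MvPolynomial.X (⟨(i : ℕ) - 2, by have := i.isLt; omega⟩ : Fin (r - 1)))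
        (polar G η (k + 1)))
    (z : Fin (r - 1) → A) (y : Fin (r - 1)) :
    MvPolynomial.aeval z (MvPolynomial.pderiv y δ) = ((k + 1).factorial : A) *
      (MvPolynomial.aeval (fun i : Fin (r + 1) => Polynomial.C (algebraMap Ω A (η i)) + Polynomial.X *
        Polynomial.C (if _h1 : (i : ℕ) = 0 then 0
          else if _h2 : (i : ℕ) = 1 then 1
          else z (⟨(i : ℕ) - 2, by have := i.isLt; omega⟩ : Fin (r - 1))))
        (MvPolynomial.pderiv (⟨(y : ℕ) + 2, by have := y.isLt; omega⟩ : Fin (r + 1)) G)).coeff k := by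
  classical
  set D := MvPolynomial.pderiv (R := Ω) y with hD
  set xx : Fin (r + 1) → MvPolynomial (Fin (r - 1)) Ω := fun i =>
          if _h1 : (i : ℕ) = 0 then 0
          else if _h2 : (i : ℕ) = 1 then 1
          else MvPolynomial.X (⟨(i : ℕ) - 2, by have := i.isLt; omega⟩ : Fin (r - 1)) with hxx
  set P : Fin (r + 1) → Polynomial (MvPolynomial (Fin (r - 1)) Ω) := fun i =>
    Polynomial.C (algebraMap Ω _ (η i)) + Polynomial.X * Polynomial.C (xx i) with hP
  set y2 : Fin (r + 1) := ⟨(y : ℕ) + 2, by have := y.isLt; omega⟩ with hy2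
  have h1 : D (MvPolynomial.map (algebraMap L Ω) δ) = ((k + 1).factorial : MvPolynomial (Fin (r - 1)) Ω) *
      (MvPolynomial.aeval P (MvPolynomial.pderiv y2 G)).coeff k := by
    rw [hδ, aeval_polar, Derivation.leibniz, Derivation.map_natCast, smul_zero, add_zero, smul_eq_mul,
      ← coeff_coeffDer, chain_rule (R := Ω) (A := Ω) (coeffDer D), Finset.sum_eq_single y2]
    · have : coeffDer D (P y2) = Polynomial.X := by
        ext1 n
        rw [coeff_coeffDer, hP]
        rcases n with _ | n
        · simp
        · simp [Polynomial.coeff_X, Polynomial.coeff_C, hxx, hy2, hD]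
          split_ifs <;> simp
      rw [this, Polynomial.coeff_mul_X]
    · intro i _ hi
      have : coeffDer D (P i) = 0 := by
        ext1 n
        rw [coeff_coeffDer, hP]
        rcases n with _ | n
        · simp
        · simp only [Polynomial.coeff_add, Polynomial.coeff_X_mul, map_add, Polynomial.coeff_C, hxx]
          split_ifs with h1 h2 h3 <;> simp [hD]
          all_goals
            apply Pi.single_eq_of_ne
            intro h
            apply hi
            have := congrArg Fin.val h
            simp at this
            apply Fin.ext
            simp only [hy2]
            omega
      rw [this, mul_zero]
    · simp
    · intro c
      ext1 n
      rw [coeff_coeffDer]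
      change D ((Polynomial.C (algebraMap Ω (MvPolynomial (Fin (r - 1)) Ω) c)).coeff n) = _
      rw [Polynomial.coeff_C]
      split_ifs <;> simp
  rw [← MvPolynomial.aeval_map_algebraMap Ω z, ← MvPolynomial.pderiv_map, h1, map_mul, map_natCast]
  congr 1
  have h2 := congrArg (fun p => Polynomial.coeff p k) (AlgHom.comp_apply
    (Polynomial.mapAlgHom (MvPolynomial.aeval (R := Ω) z)) (MvPolynomial.aeval P)
      (MvPolynomial.pderiv y2 G))
  rw [MvPolynomial.comp_aeval] at h2
  simp only [Polynomial.coe_mapAlgHom, Polynomial.coeff_map] at h2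
  refine Eq.trans h2.symm ?_
  congr 3
  funext i
  simp only [hP, hxx, Polynomial.map_add, Polynomial.map_mul, Polynomial.map_C, Polynomial.map_X]
  have ha : ((MvPolynomial.aeval (R := Ω) z : MvPolynomial (Fin (r - 1)) Ω →ₐ[Ω] A) :
      MvPolynomial (Fin (r - 1)) Ω →+* A) (algebraMap Ω _ (η i)) = algebraMap Ω A (η i) := by
    exact (MvPolynomial.aeval (R := Ω) z).commutes (η i)
  rw [ha]
  split_ifs <;> simp

theorem case0 {K L Ω : Type*} [Field K] [Field L] [Field Ω] [Algebra K Ω] [Algebra L Ω] {q r e D : ℕ}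
    (he : 2 ≤ e) (heq : e ≤ q) (hqr : q < r) (hD : D = e + 2)
    (G : MvPolynomial (Fin (r + 1)) Ω)
    (hGz : ∀ μ : Fin (r + 1) →₀ ℕ,
      ¬ ((∑ i, μ i) = D ∧ ∃ i : Fin (r + 1), q < (i : ℕ) ∧ μ i ≠ 0) → G.coeff μ = 0)
    (hY : ∀ μ ∈ G.support, ∃ i : Fin (r + 1), q < (i : ℕ) ∧ μ i ≠ 0)
    (η ξ : Fin (r + 1) → Ω) (hη0 : η 0 = 1) (hηz : ∀ i : Fin (r + 1), e < (i : ℕ) → η i = 0)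
    (hx : AlgebraicIndependent K (Sum.elim (fun μ : Mon q r D => G.coeff μ.1)
      (fun j : Fin e => η ⟨(j : ℕ) + 1, by have := j.isLt; omega⟩)))
    (δ' : ℕ → MvPolynomial (Fin (r - 1)) L)
    (hδ' : ∀ j, MvPolynomial.map (algebraMap L Ω) (δ' j)
      = MvPolynomial.aeval (fun i : Fin (r + 1) =>
          if _h1 : (i : ℕ) = 0 then 0
          else if _h2 : (i : ℕ) = 1 then 1
          else MvPolynomial.X (⟨(i : ℕ) - 2, by have := i.isLt; omega⟩ : Fin (r - 1)))
        (polar G η j))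
    (J : Ideal (MvPolynomial (Fin (r - 1)) L))
    (hJ : J = Ideal.span {p | ∃ j : ℕ, 1 ≤ j ∧ j ≤ e ∧ p = δ' j})
    (hξgen : ∀ p, MvPolynomial.aeval
        (fun i : Fin (r - 1) => ξ ⟨(i : ℕ) + 2, by have := i.isLt; omega⟩) p = 0
      ↔ p ∈ J)
    (m : ℕ) (hm : m + e = r - 1) (v : Fin m → Ω)
    (hv : ∀ i : Fin (r - 1), IsAlgebraic (IntermediateField.adjoin L (Set.range v))
      (ξ ⟨(i : ℕ) + 2, by have := i.isLt; omega⟩))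
    (hall : ∀ i : Fin (r + 1), q < (i : ℕ) → ξ i = 0) : False := by
  classical
  -- the polars vanish when all Y-coordinates vanish
  have hvan : ∀ {A : Type _} [CommRing A] [Algebra Ω A] [Algebra L A] [IsScalarTower L Ω A]
      (z : Fin (r - 1) → A) (_ : ∀ i : Fin (r - 1), q < (i : ℕ) + 2 → z i = 0) (j : ℕ),
      MvPolynomial.aeval z (δ' j) = 0 := by
    intro A _ _ _ _ z hz j
    rw [aeval_delta (polar G η j) (δ' j) (hδ' j) z, aeval_polar, aeval_zero_of_Y G hY, Polynomial.coeff_zero,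
      mul_zero]
    intro i hi
    have h0 : ¬ ((i : ℕ) = 0) := by omega
    have h1 : ¬ ((i : ℕ) = 1) := by omega
    simp only [h0, h1, dif_neg, not_false_eq_true]
    rw [hηz i (by omega), hz _ (by simp only; omega)]
    simp
  have hJgen : J = Ideal.span (Set.range (fun j : Fin e => δ' ((j : ℕ) + 1))) := by
    rw [hJ]
    congr 1
    ext p
    constructor
    · rintro ⟨j, h1, h2, rfl⟩
      exact ⟨⟨j - 1, by omega⟩, by simp only; congr 1; omega⟩
    · rintro ⟨j, rfl⟩
      exact ⟨(j : ℕ) + 1, by omega, by have := j.2; omega, rfl⟩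
  -- the ξ coordinates of index ≤ q are independent
  have hq1 : q - 1 ≤ m := by
    have hind : AlgebraicIndependent L (fun i : Fin (q - 1) =>
        ξ ⟨(i : ℕ) + 2, by have := i.isLt; omega⟩) := by
      rw [AlgebraicIndependent, injective_iff_map_eq_zero]
      intro p hp
      set g : Fin (q - 1) → Fin (r - 1) := Fin.castLE (by omega) with hg
      have hp2 : MvPolynomial.rename g p ∈ J := by
        rw [← hξgen, MvPolynomial.aeval_rename]
        exact hp
      set z : Fin (r - 1) → MvPolynomial (Fin (q - 1)) Ω := fun i =>
        if h : (i : ℕ) < q - 1 then MvPolynomial.X ⟨i, h⟩ else 0 with hz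
      have hz0 : ∀ P ∈ J, MvPolynomial.aeval z P = 0 := by
        have : J ≤ RingHom.ker (MvPolynomial.aeval (R := L) z) := by
          rw [hJgen, Ideal.span_le]
          rintro _ ⟨j, rfl⟩
          apply hvan
          intro i hi
          simp only [hz]
          rw [dif_neg (by omega)]
        exact fun P hP => this hP
      have h3 := hz0 _ hp2
      rw [MvPolynomial.aeval_rename] at h3
      have h4 : z ∘ g = MvPolynomial.X := by
        funext i
        simp [hz, hg]
      rw [h4, ← MvPolynomial.aeval_map_algebraMap Ω, MvPolynomial.aeval_X_left_apply] at h3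
      exact (map_eq_zero_iff _ (MvPolynomial.map_injective _ (algebraMap L Ω).injective)).1 h3
    have := card_le_of_algInd _ v hind (fun i => hv (Fin.castLE (by omega) i))
    simpa using this
  -- unit matrix relation
  set z : Fin (r - 1) → Polynomial Ω := fun i => if (i : ℕ) = 0 then Polynomial.X else 0 with hz
  have hz0 : ∀ j, MvPolynomial.aeval z (δ' j) = 0 := by
    apply hvan
    intro i hi
    simp only [hz]
    rw [if_neg (by omega)]
  set Y := {i : Fin (r + 1) // q < (i : ℕ)} with hYdef
  set y2 : Y → Fin (r - 1) := fun y => ⟨(y.1 : ℕ) - 2, by have := y.1.2; have := y.2; omega⟩ with hy2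
  have hy2inj : Function.Injective y2 := by
    intro a b h
    have := congrArg Fin.val h
    simp only [hy2] at this
    have := a.2
    have := b.2
    exact Subtype.ext (Fin.ext (by omega))
  have hy22 : ∀ y : Y, (⟨(y2 y : ℕ) + 2, by have := (y2 y).isLt; omega⟩ : Fin (r + 1)) = y.1 := by
    intro y
    have h := y.2
    apply Fin.ext
    change (y.1 : ℕ) - 2 + 2 = (y.1 : ℕ)
    omega
  have hXJ : ∀ y : Y, ∃ h : Fin e → MvPolynomial (Fin (r - 1)) L,
      ∑ j, h j * δ' ((j : ℕ) + 1) = MvPolynomial.X (y2 y) := by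
    intro y
    have : MvPolynomial.X (y2 y) ∈ J := by
      rw [← hξgen, MvPolynomial.aeval_X]
      rw [hy22 y]
      exact hall y.1 y.2
    rw [hJgen, Ideal.mem_span_range_iff_exists_fun] at this
    exact this
  choose H hH using hXJ
  set P : Fin (r + 1) → Polynomial (Polynomial Ω) := fun i =>
    Polynomial.C (Polynomial.C (η i)) + Polynomial.X * Polynomial.C (Polynomial.C
      (if (i : ℕ) = 1 then 1 else 0) + Polynomial.X * Polynomial.C (if (i : ℕ) = 2 then 1 else 0)) with hP
  set N : Fin e → Y → Polynomial Ω := fun j y =>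
    (MvPolynomial.aeval P (MvPolynomial.pderiv y.1 G)).coeff (j : ℕ) with hN
  have hPP : (fun i : Fin (r + 1) => Polynomial.C (algebraMap Ω (Polynomial Ω) (η i)) + Polynomial.X *
        Polynomial.C (if _h1 : (i : ℕ) = 0 then 0
          else if _h2 : (i : ℕ) = 1 then 1
          else z (⟨(i : ℕ) - 2, by have := i.isLt; omega⟩ : Fin (r - 1)))) = P := by
    funext i
    simp only [hP, hz]
    have : algebraMap Ω (Polynomial Ω) (η i) = Polynomial.C (η i) := rfl
    rw [this]
    congr 3
    by_cases h0 : (i : ℕ) = 0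
    · simp [h0]
    by_cases h1 : (i : ℕ) = 1
    · simp [h1]
    by_cases h2 : (i : ℕ) = 2
    · simp [h2]
    · have : (i : ℕ) - 2 ≠ 0 := by omega
      simp [h0, h1, h2, this]
  have hder : ∀ (j : Fin e) (y : Y), MvPolynomial.aeval z (MvPolynomial.pderiv (y2 y) (δ' ((j : ℕ) + 1))) =
      (((j : ℕ) + 1).factorial : Polynomial Ω) * N j y := by
    intro j y
    refine (delta_pderiv G η j (δ' ((j : ℕ) + 1)) (hδ' _) z (y2 y)).trans ?_
    rw [hy22 y, hPP]
  have hone : ∀ y y' : Y, ∑ j, (MvPolynomial.aeval z (H y j) * (((j : ℕ) + 1).factorial : Polynomial Ω)) *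
      N j y' = if y = y' then 1 else 0 := by
    intro y y'
    have h1 := congrArg (fun Q => MvPolynomial.aeval z (MvPolynomial.pderiv (y2 y') Q)) (hH y)
    simp only [map_sum, Derivation.leibniz, smul_eq_mul, map_add, map_mul, hz0, zero_mul, add_zero,
      hder] at h1
    simp only [mul_assoc]
    rw [h1]
    by_cases hyy : y = y'
    · rw [hyy]; simp
    · rw [MvPolynomial.pderiv_X_of_ne (fun h => hyy (hy2inj h)), if_neg hyy, map_zero]
  -- cardinalities
  have hYcard : Fintype.card Y = r - q := by
    have e1 : Y ≃ Fin (r - q) :=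
      { toFun := fun y => ⟨(y.1 : ℕ) - (q + 1), by have := y.1.2; have := y.2; omega⟩
        invFun := fun k => ⟨⟨(k : ℕ) + q + 1, by have := k.2; omega⟩, by simp only; omega⟩
        left_inv := fun y => by
          apply Subtype.ext; apply Fin.ext; simp only; have := y.2; omega
        right_inv := fun k => by apply Fin.ext; simp only; omega }
    rw [Fintype.card_congr e1, Fintype.card_fin]
  have hcardle : Fintype.card (Fin e) ≤ Fintype.card Y := by
    rw [hYcard, Fintype.card_fin]; omega
  obtain ⟨emb⟩ := Function.Embedding.nonempty_of_card_le hcardle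
  set Hm : Matrix (Fin e) (Fin e) (Polynomial Ω) := Matrix.of fun a j =>
    MvPolynomial.aeval z (H (emb a) j) * (((j : ℕ) + 1).factorial : Polynomial Ω) with hHm
  set Nm : Matrix (Fin e) (Fin e) (Polynomial Ω) := Matrix.of fun j a => N j (emb a) with hNm
  have hHN : Hm * Nm = 1 := by
    ext1 a b
    rw [Matrix.mul_apply, Matrix.one_apply]
    simp only [hHm, hNm, Matrix.of_apply]
    rw [hone]
    simp only [emb.injective.eq_iff]
  have hunit : IsUnit Nm.det := by
    have := congrArg Matrix.det hHN
    rw [Matrix.det_mul, Matrix.det_one, mul_comm] at this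
    exact IsUnit.of_mul_eq_one _ this
  have hdeg : Nm.det.natDegree = 0 := Polynomial.natDegree_eq_zero_of_isUnit hunit
  have hlead := coeff_det_nonunif Nm (fun j => (j : ℕ)) (fun j a =>
    (lead_coeff (MvPolynomial.pderiv (emb a).1 G) η _ _ j).1)
  have hpos : 0 < ∑ i : Fin e, (i : ℕ) := by
    refine Finset.sum_pos' (fun _ _ => Nat.zero_le _) ⟨⟨1, by omega⟩, Finset.mem_univ _, by simp⟩
  rw [Polynomial.coeff_eq_zero_of_natDegree_lt (by omega)] at hlead
  have hT0 := T0_ind he heq (by omega) hD G hGz η hη0 hηz hx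
  have hT1 := hT0.comp (fun s : Fin e × Fin e => (emb s.2, s.1)) (by
    rintro ⟨a, b⟩ ⟨c, d⟩ h
    simpa [and_comm] using h)
  set Tm : Fin e → Fin e → Ω := fun j a => (MvPolynomial.aeval (fun i : Fin (r + 1) =>
    Polynomial.C (η i) + Polynomial.X * Polynomial.C (if (i : ℕ) = 2 then 1 else 0))
      (MvPolynomial.pderiv (emb a).1 G)).coeff (j : ℕ) with hTm
  have hT2 : AlgebraicIndependent K (fun s : Fin e × Fin e => Tm s.1 s.2) := hT1
  have hT3 := det_ne_zero_of_algInd Tm hT2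
  apply hT3
  rw [hlead]
  congr 2
  funext j a
  exact ((lead_coeff (MvPolynomial.pderiv (emb a).1 G) η _ _ j).2).symm

theorem isAlgebraic_of_derivation {F Ω : Type u} [Field F] [Field Ω] [Algebra F Ω]
    {ι : Type*} [Finite ι] (x : ι → Ω)
    (h : ∀ D : Derivation F (IntermediateField.adjoin F (Set.range x))
        (IntermediateField.adjoin F (Set.range x)),
      ∀ i, D ⟨x i, IntermediateField.subset_adjoin _ _ ⟨i, rfl⟩⟩ = 0) :
    ∀ i, IsAlgebraic F (x i) := by
  have hess : Algebra.EssFiniteType F (IntermediateField.adjoin F (Set.range x)) := by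
    rw [IntermediateField.essFiniteType_iff]
    exact IntermediateField.fg_adjoin_of_finite (Set.finite_range x)
  have hD : ∀ D : Derivation F (IntermediateField.adjoin F (Set.range x))
        (IntermediateField.adjoin F (Set.range x)), ∀ a, D a = 0 := by
    rintro D ⟨a, ha⟩
    induction ha using IntermediateField.adjoin_induction with
    | mem y hy => obtain ⟨i, rfl⟩ := hy; exact h D i
    | algebraMap y => exact D.map_algebraMap y
    | add y z hy hz h1 h2 =>
      have := D.map_add ⟨y, hy⟩ ⟨z, hz⟩
      rw [h1, h2, add_zero] at this
      exact this
    | inv y hy h1 =>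
      have := D.leibniz_inv ⟨y, hy⟩
      rw [h1, smul_zero] at this
      exact this
    | mul y z hy hz h1 h2 =>
      have := D.leibniz ⟨y, hy⟩ ⟨z, hz⟩
      rw [h1, h2, smul_zero, smul_zero, add_zero] at this
      exact this
  have hunr : Algebra.FormallyUnramified F (IntermediateField.adjoin F (Set.range x)) := by
    constructor
    refine subsingleton_of_forall_eq 0 fun w => ?_
    rw [← Module.forall_dual_apply_eq_zero_iff (IntermediateField.adjoin F (Set.range x))]
    intro φ
    have : φ = 0 := by
      apply Derivation.liftKaehlerDifferential_unique
      ext a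
      rw [hD (φ.compDer _)]
      simp
    rw [this]; rfl
  have hsep := (Algebra.FormallyUnramified.iff_isSeparable F _).1 hunr
  intro i
  have h1 := (Algebra.IsSeparable.isIntegral F (⟨x i, IntermediateField.subset_adjoin _ _ ⟨i, rfl⟩⟩ :
    IntermediateField.adjoin F (Set.range x))).isAlgebraic
  exact (isAlgebraic_algebraMap_iff (S := IntermediateField.adjoin F (Set.range x)) (A := Ω)
    (FaithfulSMul.algebraMap_injective _ _)).2 h1

theorem eta_alg {F Ω : Type u} [Field F] [Field Ω] [Algebra F Ω] {r e : ℕ} (her : e + 1 ≤ r)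
    (G : MvPolynomial (Fin (r + 1)) F) (β : Fin (r + 1) → F) (η : Fin (r + 1) → Ω)
    (hη0 : η 0 = 1) (hηz : ∀ i : Fin (r + 1), e < (i : ℕ) → η i = 0)
    (hf : ∀ k, k ≤ e → (MvPolynomial.aeval (fun i => Polynomial.C (η i) + Polynomial.X *
      Polynomial.C (algebraMap F Ω (β i) - η i)) G).coeff k = 0)
    (hT : (Matrix.of (fun i k : Fin e => ((MvPolynomial.aeval (fun i => Polynomial.C (η i) + Polynomial.X *
      Polynomial.C (algebraMap F Ω (β i) - η i)) 
        (MvPolynomial.pderiv (⟨(i : ℕ) + 1, by have := i.isLt; omega⟩ : Fin (r + 1)) G)).coeff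
          ((k : ℕ) + 1) : Ω))).det ≠ 0) :
    ∀ i, IsAlgebraic F (η i) := by
  classical
  apply isAlgebraic_of_derivation
  set E := IntermediateField.adjoin F (Set.range η) with hE
  intro (D : Derivation F E E)
  set x : Fin (r + 1) → E := fun i => ⟨η i, IntermediateField.subset_adjoin _ _ ⟨i, rfl⟩⟩ with hx
  set p : Fin (r + 1) → Polynomial E := fun i => Polynomial.C (x i) + Polynomial.X *
      Polynomial.C (algebraMap F E (β i) - x i) with hp
  have hmap : ∀ (Q : MvPolynomial (Fin (r + 1)) F) k,
      algebraMap E Ω ((MvPolynomial.aeval p Q).coeff k) =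
        (MvPolynomial.aeval (fun i => Polynomial.C (η i) + Polynomial.X *
      Polynomial.C (algebraMap F Ω (β i) - η i)) Q).coeff k := by
    intro Q k
    have h2 := congrArg (fun p => Polynomial.coeff p k) (AlgHom.comp_apply
      (Polynomial.mapAlgHom (IsScalarTower.toAlgHom F E Ω)) (MvPolynomial.aeval p) Q)
    rw [MvPolynomial.comp_aeval] at h2
    simp only [Polynomial.coe_mapAlgHom, Polynomial.coeff_map] at h2
    refine Eq.trans h2.symm ?_
    congr 3
    funext i
    simp only [hp, Polynomial.map_add, Polynomial.map_mul, Polynomial.map_C, Polynomial.map_X]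
    rfl
  have hf' : ∀ k, k ≤ e → (MvPolynomial.aeval p G).coeff k = 0 := by
    intro k hk
    apply (algebraMap E Ω).injective
    rw [hmap, hf k hk, map_zero]
  set S : Polynomial E := ∑ i, MvPolynomial.aeval p (MvPolynomial.pderiv i G) *
    Polynomial.C (D (x i)) with hS
  have hS1 : coeffDer D (MvPolynomial.aeval p G) = S - S * Polynomial.X := by
    rw [chain_rule (R := F) (coeffDer D) _ p G, hS, Finset.sum_mul, ← Finset.sum_sub_distrib]
    · refine Finset.sum_congr rfl fun i _ => ?_
      have : coeffDer D (p i) = Polynomial.C (D (x i)) - Polynomial.C (D (x i)) * Polynomial.X := by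
        ext1 n
        rw [coeff_coeffDer, hp]
        rcases n with _ | n
        · simp
        · simp only [Polynomial.coeff_add, Polynomial.coeff_X_mul, Polynomial.coeff_C, Polynomial.coeff_sub,
            Polynomial.coeff_mul_X]
          by_cases hn : n = 0 <;> simp [hn]
      rw [this, mul_sub, mul_assoc]
    · intro c
      ext1 n
      rw [coeff_coeffDer]
      change D ((Polynomial.C (algebraMap F E c)).coeff n) = _
      rw [Polynomial.coeff_C]
      split_ifs <;> simp
  have hS2 : ∀ k, k ≤ e → S.coeff k = 0 := by
    have h0 : ∀ k, k ≤ e → (S - S * Polynomial.X).coeff k = 0 := by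
      intro k hk
      rw [← hS1, coeff_coeffDer, hf' k hk, map_zero]
    intro k
    induction k with
    | zero => intro hk; simpa using h0 0 hk
    | succ k ih =>
      intro hk
      have := h0 (k + 1) hk
      rw [Polynomial.coeff_sub, Polynomial.coeff_mul_X, ih (by omega), sub_zero] at this
      exact this
  set c : Fin e → Ω := fun i => (D (x ⟨(i : ℕ) + 1, by have := i.isLt; omega⟩) : Ω) with hc
  have hDz : ∀ i : Fin (r + 1), ((i : ℕ) = 0 ∨ e < (i : ℕ)) → D (x i) = 0 := by
    rintro i (hi | hi)
    · have h1 : x i = 1 := by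
        have : i = 0 := Fin.ext hi
        apply Subtype.ext
        rw [this]; exact hη0
      rw [h1, D.map_one_eq_zero]
    · have h1 : x i = 0 := Subtype.ext (hηz i hi)
      rw [h1, map_zero]
  have hc0 : c = 0 := by
    apply Matrix.eq_zero_of_vecMul_eq_zero hT
    funext k
    have h1 := congrArg (algebraMap E Ω) (hS2 ((k : ℕ) + 1) (by have := k.2; omega))
    rw [hS, Polynomial.finsetSum_coeff, map_sum, map_zero] at h1
    simp only [Polynomial.coeff_mul_C, map_mul, hmap] at h1
    rw [Pi.zero_apply, ← h1]
    simp only [Matrix.vecMul, dotProduct, Matrix.of_apply]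
    refine Finset.sum_of_injOn (fun i : Fin e => (⟨(i : ℕ) + 1, by have := i.isLt; omega⟩ :
      Fin (r + 1))) ?_ (fun _ _ => Finset.mem_coe.2 (Finset.mem_univ _)) ?_ ?_
    · intro a _ b _ h
      have := congrArg Fin.val h
      apply Fin.ext
      simpa using this
    · intro i _ hi
      rw [hDz i, map_zero, mul_zero]
      by_contra! hcon
      apply hi
      refine ⟨⟨(i : ℕ) - 1, by omega⟩, Finset.mem_coe.2 (Finset.mem_univ _), Fin.ext ?_⟩
      simp only
      omega
    · intro i _
      rw [mul_comm]
      rfl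
  intro i
  by_cases hi : (i : ℕ) = 0 ∨ e < (i : ℕ)
  · exact hDz i hi
  · push Not at hi
    have h2 : i = ⟨((⟨(i : ℕ) - 1, by omega⟩ : Fin e) : ℕ) + 1, by omega⟩ := by
      apply Fin.ext
      simp only
      omega
    have h1 := congrFun hc0 ⟨(i : ℕ) - 1, by omega⟩
    have h3 : D (x i) = 0 := by
      rw [h2]
      exact Subtype.ext h1
    exact h3

theorem coeff_line_high {Ω : Type*} [Field Ω] {n D : ℕ} (G : MvPolynomial (Fin n) Ω)
    (hG : G.IsHomogeneous D) (η ξ : Fin n → Ω) (k : ℕ) (hk : D < k) :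
    (MvPolynomial.aeval (fun i : Fin n =>
          Polynomial.C (η i) + Polynomial.X * Polynomial.C (ξ i)) G).coeff k = 0 := by
  apply Polynomial.coeff_eq_zero_of_natDegree_lt
  refine lt_of_le_of_lt ?_ hk
  rw [MvPolynomial.aeval_def, MvPolynomial.eval₂_eq']
  refine Polynomial.natDegree_sum_le_of_forall_le _ _ fun μ hμ => ?_
  have h1 : (algebraMap Ω (Polynomial Ω)) (G.coeff μ) = Polynomial.C (G.coeff μ) := rfl
  rw [h1]
  refine (Polynomial.natDegree_C_mul_le _ _).trans ?_
  refine (Polynomial.natDegree_prod_le _ _).trans ?_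
  have h2 : ∑ i, μ i = D := by
    have := hG (MvPolynomial.mem_support_iff.1 hμ)
    rw [← this, Finsupp.weight_apply, Finsupp.sum_fintype] <;> simp
  rw [← h2]
  refine Finset.sum_le_sum fun i _ => ?_
  refine Polynomial.natDegree_pow_le.trans ?_
  have h3 : (Polynomial.C (η i) + Polynomial.X * Polynomial.C (ξ i)).natDegree ≤ 1 := by
    compute_degree
  calc μ i * _ ≤ μ i * 1 := Nat.mul_le_mul_left _ h3
    _ = μ i := mul_one _

theorem rescale_coeff {Ω : Type*} [Field Ω] {n : ℕ} (Q : MvPolynomial (Fin n) Ω)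
    (η ξ : Fin n → Ω) (t : Ω) (k : ℕ) :
    (MvPolynomial.aeval (fun i : Fin n =>
          Polynomial.C (η i) + Polynomial.X * Polynomial.C (t * ξ i)) Q).coeff k =
    t ^ k * (MvPolynomial.aeval (fun i : Fin n =>
          Polynomial.C (η i) + Polynomial.X * Polynomial.C (ξ i)) Q).coeff k := by
  rw [mul_comm, ← Polynomial.comp_C_mul_X_coeff]
  congr 1
  have h := AlgHom.comp_apply (Polynomial.aeval (R := Ω) (Polynomial.C t * Polynomial.X))
    (MvPolynomial.aeval (fun i : Fin n =>
          Polynomial.C (η i) + Polynomial.X * Polynomial.C (ξ i))) Q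
  rw [MvPolynomial.comp_aeval] at h
  refine Eq.trans ?_ h
  congr 2
  funext i
  simp only [map_add, map_mul, Polynomial.aeval_X, Polynomial.aeval_C]
  change _ = Polynomial.C _ + _ * Polynomial.C _
  ring

theorem final_trdeg {k Ω : Type u} [Field k] [Field Ω] [Algebra k Ω] {r e : ℕ}
    (he : 2 ≤ e) (her : e + 1 ≤ r)
    (G : MvPolynomial (Fin (r + 1)) Ω) (hGk : ∀ μ, G.coeff μ ∈ Set.range (algebraMap k Ω))
    (η ξ : Fin (r + 1) → Ω) (hη0 : η 0 = 1) (hηz : ∀ i : Fin (r + 1), e < (i : ℕ) → η i = 0)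
    (hξ0 : ξ 0 = 0) (hξ1 : ξ ⟨1, by omega⟩ = 1) (m : ℕ) (hm : m + e = r - 1) (v : Fin m → Ω)
    (hz : AlgebraicIndependent k
      (Sum.elim (fun j : Fin e => η ⟨(j : ℕ) + 1, by have := j.isLt; omega⟩) v))
    (hv : ∀ E : IntermediateField k Ω, (∀ i, η i ∈ E) → (∀ i, ξ i ∈ E) → ∀ i, v i ∈ E)
    (hξ : ∀ E : IntermediateField k Ω, (∀ i, η i ∈ E) → (∀ i, v i ∈ E) → ∀ i, IsAlgebraic E (ξ i))
    (hf : ∀ k, k ≤ e → (MvPolynomial.aeval (fun i : Fin (r + 1) =>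
          Polynomial.C (η i) + Polynomial.X * Polynomial.C (ξ i)) G).coeff k = 0)
    (hT : (Matrix.of (fun i k : Fin e => ((MvPolynomial.aeval (fun i : Fin (r + 1) =>
          Polynomial.C (η i) + Polynomial.X * Polynomial.C (ξ i))
        (MvPolynomial.pderiv (⟨(i : ℕ) + 1, by have := i.isLt; omega⟩ : Fin (r + 1)) G)).coeff
          ((k : ℕ) + 1) : Ω))).det ≠ 0)
    (t : Ω) (ht : t ≠ 0)
    (htE : ∀ E : IntermediateField k Ω, (∀ i, η i ∈ E) → (∀ i, ξ i ∈ E) → t ∈ E) :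
    FieldTrdegEq k Ω (Set.range fun i : Fin r =>
          η ⟨(i : ℕ) + 1, by have := i.isLt; omega⟩
            + t * ξ ⟨(i : ℕ) + 1, by have := i.isLt; omega⟩) (r - 1) := by
  classical
  set s := (Set.range fun i : Fin r =>
          η ⟨(i : ℕ) + 1, by have := i.isLt; omega⟩
            + t * ξ ⟨(i : ℕ) + 1, by have := i.isLt; omega⟩) with hs
  have hβ : ∀ i : Fin (r + 1), η i + t * ξ i ∈ IntermediateField.adjoin k s := by
    intro i
    by_cases hi : i = 0
    · rw [hi, hη0, hξ0, mul_zero, add_zero]; exact one_mem _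
    · apply IntermediateField.subset_adjoin
      have : (i : ℕ) ≠ 0 := fun h => hi (Fin.ext h)
      have hlt := i.isLt
      refine ⟨⟨(i : ℕ) - 1, by omega⟩, ?_⟩
      have h2 : (⟨(i : ℕ) - 1 + 1, by omega⟩ : Fin (r + 1)) = i := Fin.ext (by simp only; omega)
      simp only [h2]
  -- direction one
  have hGF : ∃ G' : MvPolynomial (Fin (r + 1)) (IntermediateField.adjoin k s),
      MvPolynomial.map (algebraMap (IntermediateField.adjoin k s) Ω) G' = G := by
    rw [← Set.mem_range, MvPolynomial.mem_range_map_iff_coeffs_subset]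
    intro c hc
    obtain ⟨μ, _, rfl⟩ := MvPolynomial.mem_coeffs_iff.1 hc
    obtain ⟨a, ha⟩ := hGk μ
    exact ⟨algebraMap k _ a, ha⟩
  obtain ⟨G', hG'⟩ := hGF
  have hq : (fun i : Fin (r + 1) => Polynomial.C (η i) + Polynomial.X *
      Polynomial.C (algebraMap (IntermediateField.adjoin k s) Ω ⟨η i + t * ξ i, hβ i⟩ - η i)) =
      fun i => Polynomial.C (η i) + Polynomial.X * Polynomial.C (t * ξ i) := by
    funext i
    congr 3
    change η i + t * ξ i - η i = _
    ring
  have hη : ∀ i, IsAlgebraic (IntermediateField.adjoin k s) (η i) := by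
    apply eta_alg her G' (fun i => ⟨η i + t * ξ i, hβ i⟩) η hη0 hηz
    · intro j hj
      rw [hq, ← MvPolynomial.aeval_map_algebraMap Ω, hG', rescale_coeff, hf j hj, mul_zero]
    · rw [hq]
      have : ∀ i j : Fin e, ((MvPolynomial.aeval (fun i : Fin (r + 1) =>
          Polynomial.C (η i) + Polynomial.X * Polynomial.C (t * ξ i))
        (MvPolynomial.pderiv (⟨(i : ℕ) + 1, by have := i.isLt; omega⟩ : Fin (r + 1)) G')).coeff
          ((j : ℕ) + 1) : Ω) = t ^ ((j : ℕ) + 1) * ((MvPolynomial.aeval (fun i : Fin (r + 1) =>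
          Polynomial.C (η i) + Polynomial.X * Polynomial.C (ξ i))
        (MvPolynomial.pderiv (⟨(i : ℕ) + 1, by have := i.isLt; omega⟩ : Fin (r + 1)) G)).coeff
          ((j : ℕ) + 1) : Ω) := by
        intro i j
        rw [← MvPolynomial.aeval_map_algebraMap Ω, ← MvPolynomial.pderiv_map, hG', rescale_coeff]
      simp only [this]
      have h2 := Matrix.det_mul_row (fun j : Fin e => t ^ ((j : ℕ) + 1)) (Matrix.of (fun i k : Fin e => ((MvPolynomial.aeval (fun i : Fin (r + 1) =>
          Polynomial.C (η i) + Polynomial.X * Polynomial.C (ξ i))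
        (MvPolynomial.pderiv (⟨(i : ℕ) + 1, by have := i.isLt; omega⟩ : Fin (r + 1)) G)).coeff
          ((k : ℕ) + 1) : Ω)))
      simp only [Matrix.of_apply] at h2
      rw [h2]
      exact mul_ne_zero (Finset.prod_ne_zero_iff.2 fun _ _ => pow_ne_zero _ ht) hT
  have dir1 : ∀ i, IsAlgebraic (IntermediateField.adjoin k s)
      (Sum.elim (fun j : Fin e => η ⟨(j : ℕ) + 1, by have := j.isLt; omega⟩) v i) := by
    set N := (algebraicClosure (IntermediateField.adjoin k s) Ω).restrictScalars k with hN
    have hNm : ∀ a, a ∈ N ↔ IsAlgebraic (IntermediateField.adjoin k s) a := fun a =>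
      mem_algebraicClosure_iff
    have hηN : ∀ i, η i ∈ N := fun i => (hNm _).2 (hη i)
    have hβN : ∀ i, η i + t * ξ i ∈ N := fun i => (hNm _).2
      (isAlgebraic_algebraMap (⟨η i + t * ξ i, hβ i⟩ : IntermediateField.adjoin k s))
    have hmN : ∀ i, t * ξ i ∈ N := fun i => by
      have := sub_mem (hβN i) (hηN i)
      rwa [add_sub_cancel_left] at this
    have htN : t ∈ N := by
      have := hmN ⟨1, by omega⟩
      rwa [hξ1, mul_one] at this
    have hξN : ∀ i, ξ i ∈ N := fun i => by
      have := mul_mem (inv_mem htN) (hmN i)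
      rwa [inv_mul_cancel_left₀ ht] at this
    rintro (i | i)
    · exact hη _
    · exact (hNm _).1 (hv N hηN hξN i)
  have dir2 : ∀ a ∈ s, IsAlgebraic (IntermediateField.adjoin k (Set.range
      (Sum.elim (fun j : Fin e => η ⟨(j : ℕ) + 1, by have := j.isLt; omega⟩) v))) a := by
    set E := IntermediateField.adjoin k (Set.range
      (Sum.elim (fun j : Fin e => η ⟨(j : ℕ) + 1, by have := j.isLt; omega⟩) v)) with hE
    set N := (algebraicClosure E Ω).restrictScalars k with hN
    have hNm : ∀ a, a ∈ N ↔ IsAlgebraic E a := fun a => mem_algebraicClosure_iff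
    have hEN : ∀ a ∈ E, a ∈ N := fun a ha => (hNm _).2 (isAlgebraic_algebraMap (⟨a, ha⟩ : E))
    have hηE : ∀ i, η i ∈ E := by
      intro i
      by_cases hi0 : i = 0
      · rw [hi0, hη0]; exact one_mem _
      by_cases hie : e < (i : ℕ)
      · rw [hηz i hie]; exact zero_mem _
      have : (i : ℕ) ≠ 0 := fun h => hi0 (Fin.ext h)
      apply IntermediateField.subset_adjoin
      refine ⟨Sum.inl ⟨(i : ℕ) - 1, by omega⟩, ?_⟩
      have h2 : (⟨(i : ℕ) - 1 + 1, by omega⟩ : Fin (r + 1)) = i := Fin.ext (by simp only; omega)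
      simp only [Sum.elim_inl, h2]
    have hvE : ∀ i, v i ∈ E := fun i => IntermediateField.subset_adjoin _ _ ⟨Sum.inr i, rfl⟩
    have hξN : ∀ i, ξ i ∈ N := fun i => (hNm _).2 (hξ E hηE hvE i)
    have hηN : ∀ i, η i ∈ N := fun i => hEN _ (hηE i)
    have htN : t ∈ N := htE N hηN hξN
    rintro _ ⟨i, rfl⟩
    exact (hNm _).1 (add_mem (hηN _) (mul_mem htN (hξN _)))
  refine fieldTrdegEq_of _ hz s dir1 dir2 _ ?_
  rw [Fintype.card_sum, Fintype.card_fin, Fintype.card_fin]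
  omega

def incl {K₁ K₂ Ω : Type*} [Field K₁] [Field K₂] [Field Ω] [Algebra K₁ Ω] [Algebra K₂ Ω]
    (E₁ : IntermediateField K₁ Ω) (E₂ : IntermediateField K₂ Ω) (h : ∀ a ∈ E₁, a ∈ E₂) : E₁ →+* E₂ where
  toFun a := ⟨a.1, h a.1 a.2⟩
  map_one' := rfl
  map_zero' := rfl
  map_mul' _ _ := rfl
  map_add' _ _ := rfl

theorem isAlgebraic_of_le {K₁ K₂ Ω : Type*} [Field K₁] [Field K₂] [Field Ω] [Algebra K₁ Ω] [Algebra K₂ Ω]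
    (E₁ : IntermediateField K₁ Ω) (E₂ : IntermediateField K₂ Ω) (h : ∀ a ∈ E₁, a ∈ E₂) (x : Ω)
    (hx : IsAlgebraic E₁ x) : IsAlgebraic E₂ x := by
  letI : Algebra E₁ E₂ := (incl E₁ E₂ h).toAlgebra
  haveI : IsScalarTower E₁ E₂ Ω := IsScalarTower.of_algebraMap_eq fun _ => rfl
  exact hx.extendScalars (incl E₁ E₂ h).injective

theorem algInd_tower {K₁ K₂ Ω : Type*} [Field K₁] [Field K₂] [Field Ω] [Algebra K₁ Ω] [Algebra K₂ Ω]
    (E₁ : IntermediateField K₁ Ω) (E₂ : IntermediateField K₂ Ω) (h : ∀ a ∈ E₁, a ∈ E₂)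
    {ι κ : Type*} (x : ι → Ω) (y : κ → Ω) (hx : AlgebraicIndependent E₁ x) (hxE : ∀ i, x i ∈ E₂)
    (hy : AlgebraicIndependent E₂ y) : AlgebraicIndependent E₁ (Sum.elim x y) := by
  letI : Algebra E₁ E₂ := (incl E₁ E₂ h).toAlgebra
  haveI : IsScalarTower E₁ E₂ Ω := IsScalarTower.of_algebraMap_eq fun _ => rfl
  have h1 := hx.sumElim_of_tower (S := E₂) (by
      rintro _ ⟨i, rfl⟩
      exact ⟨⟨_, hxE i⟩, rfl⟩) hy
  have h2 := h1.comp (Equiv.sumComm _ _) (Equiv.injective _)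
  convert h2 using 1
  funext i
  rcases i with i | i <;> rfl

/-- **The residual-point lemma (Lemma 7 of the paper, after Ciliberto).** Let `K'` be a
field of characteristic zero, `d ≥ 3`, `2d - 2 ≤ q < r`, and let
`G = Σ_{|I|<2d} b_{I,J} Z^I Y^J` be homogeneous of degree `2d` in
`Z_0, …, Z_q, Y_{q+1}, …, Y_r` (with coefficients in an extension `Ω` of `K'`), every
monomial involving a `Y`-variable (index `> q`), all coefficients algebraically
independent over `K'`. Let `η = (1, η_1, …, η_{2d-2}, 0, …, 0)` with the `η_i`
algebraically independent over `K'(b)`. Let `F*_η` be the subvariety of `ℙ^r` defined by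
`Z_0 = 0` and the polar equations `Δ^j_η(G) = 0`, `j = 1, …, 2d-2`; in the affine chart
`Z_1 = 1` it is cut out by the ideal `J` of `K'(b,η)[x_2, …, x_r]` generated by the
dehomogenized polars `δ' j`; assume `J` is prime (`F*_η` irreducible over `K'(b,η)`) and
let `ξ = (0, 1, ξ_2, …, ξ_r)` be a generic point of `F*_η` over `K'(b,η)`: its vanishing
ideal is `J` and `trdeg_{K'(b,η)} K'(b,η)(ξ_2, …, ξ_r) = r - 2d + 1`. Then
`f(t) := G(η + tξ)` has the form `f(t) = t^{2d-1}(A + Bt)` with `A, B` both nonzero, and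
the residual intersection point `β = η + t₀ξ`, `t₀ = -A/B`, of the line `⟨η, ξ⟩` with
`B = {G = 0}` satisfies `trdeg_{K'(b)} K'(b)(β_1, …, β_r) = r - 1`: `β` is a generic
point of the hypersurface `B` over `K'_1 = K'(b)`. -/
theorem stmt_8 (K' : Type u) [Field K'] [CharZero K'] (d q r : ℕ)
    (hd : 3 ≤ d) (hdq : 2 * d - 2 ≤ q) (hqr : q < r)
    (Ω : Type u) [Field Ω] [Algebra K' Ω]
    (G : MvPolynomial (Fin (r + 1)) Ω) (hG : G.IsHomogeneous (2 * d))
    (hY : ∀ μ ∈ G.support, ∃ i : Fin (r + 1), q < (i : ℕ) ∧ μ i ≠ 0)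
    (hb : AlgebraicIndependent K'
      (fun μ : {μ : Fin (r + 1) →₀ ℕ //
        (∑ i, μ i) = 2 * d ∧ ∃ i : Fin (r + 1), q < (i : ℕ) ∧ μ i ≠ 0} => G.coeff μ.1))
    (η : Fin (r + 1) → Ω) (hη0 : η 0 = 1)
    (hηz : ∀ i : Fin (r + 1), 2 * d - 2 < (i : ℕ) → η i = 0)
    (hηind : AlgebraicIndependent
      (↥(IntermediateField.adjoin K' (Set.range G.coeff)))
      (fun j : Fin (2 * d - 2) => η ⟨(j : ℕ) + 1, by have := j.isLt; omega⟩))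
    (ξ : Fin (r + 1) → Ω) (hξ0 : ξ 0 = 0) (hξ1 : ξ ⟨1, by omega⟩ = 1)
    (δ' : ℕ → MvPolynomial (Fin (r - 1))
      (↥(IntermediateField.adjoin K' (Set.range G.coeff ∪ Set.range η))))
    (hδ' : ∀ j, MvPolynomial.map
        (algebraMap (↥(IntermediateField.adjoin K'
          (Set.range G.coeff ∪ Set.range η))) Ω) (δ' j)
      = MvPolynomial.aeval (fun i : Fin (r + 1) =>
          if _h1 : (i : ℕ) = 0 then 0
          else if _h2 : (i : ℕ) = 1 then 1
          else MvPolynomial.X (⟨(i : ℕ) - 2, by have := i.isLt; omega⟩ : Fin (r - 1)))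
        (polar G η j))
    (J : Ideal (MvPolynomial (Fin (r - 1))
      (↥(IntermediateField.adjoin K' (Set.range G.coeff ∪ Set.range η)))))
    (hJ : J = Ideal.span {p | ∃ j : ℕ, 1 ≤ j ∧ j ≤ 2 * d - 2 ∧ p = δ' j})
    (hJprime : J.IsPrime)
    (hξgen : ∀ p, MvPolynomial.aeval
        (fun i : Fin (r - 1) => ξ ⟨(i : ℕ) + 2, by have := i.isLt; omega⟩) p = 0
      ↔ p ∈ J)
    (hξtrdeg : FieldTrdegEq
      (↥(IntermediateField.adjoin K' (Set.range G.coeff ∪ Set.range η))) Ω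
      (Set.range fun i : Fin (r - 1) => ξ ⟨(i : ℕ) + 2, by have := i.isLt; omega⟩)
      (r + 1 - 2 * d)) :
    ∃ A B : Ω, A ≠ 0 ∧ B ≠ 0 ∧
      (MvPolynomial.aeval (fun i : Fin (r + 1) =>
          Polynomial.C (η i) + Polynomial.X * Polynomial.C (ξ i)) G
        = Polynomial.C A * Polynomial.X ^ (2 * d - 1)
          + Polynomial.C B * Polynomial.X ^ (2 * d)) ∧
      FieldTrdegEq (↥(IntermediateField.adjoin K' (Set.range G.coeff))) Ω
        (Set.range fun i : Fin r =>
          η ⟨(i : ℕ) + 1, by have := i.isLt; omega⟩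
            + (-A / B) * ξ ⟨(i : ℕ) + 1, by have := i.isLt; omega⟩)
        (r - 1) := by
  classical
  have hcz : CharZero Ω := charZero_of_injective_algebraMap (algebraMap K' Ω).injective
  have hGz := coeff_eq_zero_of_not_mon (q := q) G hG hY
  obtain ⟨v, hvi, hvm, hva⟩ := hξtrdeg
  have hm : r + 1 - 2 * d + (2 * d - 2) = r - 1 := by omega
  -- algebraic independence
  have hz : AlgebraicIndependent (IntermediateField.adjoin K' (Set.range G.coeff))
      (Sum.elim (fun j : Fin (2 * d - 2) => η ⟨(j : ℕ) + 1, by have := j.isLt; omega⟩) v) := by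
    refine algInd_tower _ (IntermediateField.adjoin K' (Set.range G.coeff ∪ Set.range η)) ?_ _ _ hηind ?_ hvi
    · intro a ha
      exact IntermediateField.adjoin.mono _ _ _ Set.subset_union_left ha
    · intro i
      exact IntermediateField.subset_adjoin _ _ (Or.inr ⟨_, rfl⟩)
  have hx : AlgebraicIndependent K' (Sum.elim (fun μ : Mon q r (2 * d) => G.coeff μ.1)
      (Sum.elim (fun j : Fin (2 * d - 2) => η ⟨(j : ℕ) + 1, by have := j.isLt; omega⟩) v)) := by
    have h1 := hb.sumElim_of_tower (S := IntermediateField.adjoin K' (Set.range G.coeff)) (by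
      rintro _ ⟨μ, rfl⟩
      exact ⟨⟨_, IntermediateField.subset_adjoin _ _ ⟨μ.1, rfl⟩⟩, rfl⟩) hz
    have h2 := h1.comp (Equiv.sumComm _ _) (Equiv.injective _)
    convert h2 using 1
    funext i
    rcases i with i | i <;> rfl
  have hx0 : AlgebraicIndependent K' (Sum.elim (fun μ : Mon q r (2 * d) => G.coeff μ.1)
      (fun j : Fin (2 * d - 2) => η ⟨(j : ℕ) + 1, by have := j.isLt; omega⟩)) := by
    have h2 := hx.comp (Sum.map id Sum.inl) (Sum.map_injective.2 ⟨fun _ _ h => h, Sum.inl_injective⟩)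
    convert h2 using 1
    funext i
    rcases i with i | i <;> rfl
  -- coefficients
  have hf : ∀ k, k ≠ 2 * d - 2 + 1 → k ≠ 2 * d - 2 + 2 → (MvPolynomial.aeval (fun i : Fin (r + 1) =>
          Polynomial.C (η i) + Polynomial.X * Polynomial.C (ξ i)) G).coeff k = 0 := by
    intro k hk1 hk2
    rcases Nat.eq_zero_or_pos k with h0 | h0
    · have h2 := aeval_zero_of_Y (A := Ω) G hY η (fun i hi => hηz i (by omega))
      rw [h0, Polynomial.coeff_zero_eq_aeval_zero]
      have h := AlgHom.comp_apply (Polynomial.aeval (R := Ω) (0 : Ω))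
        (MvPolynomial.aeval (fun i : Fin (r + 1) =>
          Polynomial.C (η i) + Polynomial.X * Polynomial.C (ξ i))) G
      rw [← h, MvPolynomial.comp_aeval]
      refine Eq.trans ?_ h2
      congr 2
      funext i
      simp
    by_cases hk : k ≤ 2 * d - 2
    · have h1 : δ' k ∈ J := by
        rw [hJ]
        exact Ideal.subset_span ⟨k, h0, hk, rfl⟩
      have h2 := (hξgen _).2 h1
      rw [aeval_delta (A := Ω) (polar G η k) (δ' k) (hδ' k)] at h2
      have h3 : (fun i : Fin (r + 1) =>
          if _h1 : (i : ℕ) = 0 then (0 : Ω)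
          else if _h2 : (i : ℕ) = 1 then 1
          else ξ ⟨((⟨(i : ℕ) - 2, by have := i.isLt; omega⟩ : Fin (r - 1)) : ℕ) + 2,
            by have := i.isLt; simp only; omega⟩) = ξ := by
        funext i
        split_ifs with h4 h5
        · rw [← hξ0]; congr 1; exact (Fin.ext h4).symm
        · rw [← hξ1]; congr 1; exact (Fin.ext h5).symm
        · congr 1; apply Fin.ext; simp only; omega
      rw [h3, aeval_polar] at h2
      exact (mul_eq_zero.1 h2).resolve_left (by exact_mod_cast Nat.factorial_ne_zero k)
    · exact coeff_line_high G hG η ξ k (by omega)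
  -- some Y-coordinate of the point does not vanish
  have hyex : ∃ y : Fin (r + 1), q < (y : ℕ) ∧ ξ y ≠ 0 := by
    by_contra! hall
    exact case0 (by omega) hdq hqr (by omega) G hGz hY η ξ hη0 hηz hx0 δ' hδ' J hJ hξgen _ hm v
      (fun i => hva _ ⟨i, rfl⟩) hall
  obtain ⟨y, hyq, hy⟩ := hyex
  have hvE : ∀ E : IntermediateField K' Ω, (∀ μ, G.coeff μ ∈ E) → (∀ i, η i ∈ E) → (∀ i, ξ i ∈ E) →
      ∀ i, v i ∈ E := by
    intro E h1 h2 h3 i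
    have hle : IntermediateField.adjoin K' (Set.range G.coeff ∪ Set.range η) ≤ E := by
      rw [IntermediateField.adjoin_le_iff]
      rintro _ (⟨μ, rfl⟩ | ⟨j, rfl⟩)
      exacts [h1 μ, h2 j]
    have h4 := hvm i
    have h5 : IntermediateField.adjoin (IntermediateField.adjoin K' (Set.range G.coeff ∪ Set.range η))
        (Set.range fun i : Fin (r - 1) => ξ ⟨(i : ℕ) + 2, by have := i.isLt; omega⟩) ≤
        IntermediateField.extendScalars hle := by
      rw [IntermediateField.adjoin_le_iff]
      rintro _ ⟨j, rfl⟩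
      exact h3 _
    exact h5 h4
  obtain ⟨hA, hB, hT⟩ := main_ind (by omega) hdq hqr (by omega) (by omega) G hGz η ξ hη0 hηz hξ0 hξ1 _ hm
    v hx hvE y hyq hy hf
  have e1 : 2 * d - 2 + 1 = 2 * d - 1 := by omega
  have e2 : 2 * d - 2 + 2 = 2 * d := by omega
  refine ⟨_, _, hA, hB, ?_, ?_⟩
  · ext k
    rw [Polynomial.coeff_add, Polynomial.coeff_C_mul, Polynomial.coeff_C_mul, Polynomial.coeff_X_pow,
      Polynomial.coeff_X_pow]
    by_cases h1 : k = 2 * d - 1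
    · rw [if_pos h1, if_neg (by omega), h1, e1]; ring
    by_cases h2 : k = 2 * d
    · rw [if_neg h1, if_pos h2, h2, e2]; ring
    · rw [if_neg h1, if_neg h2, hf k (by omega) (by omega)]; ring
  · refine final_trdeg (e := 2 * d - 2) (by omega) (by omega) G
      (fun μ => ⟨⟨_, IntermediateField.subset_adjoin _ _ ⟨μ, rfl⟩⟩, rfl⟩) η ξ hη0 hηz hξ0 hξ1 _ hm v hz
      ?_ ?_ (fun k hk => hf k (by omega) (by omega)) hT _ (div_ne_zero (neg_ne_zero.2 hA) hB) ?_
    · intro E h1 h2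
      exact hvE (E.restrictScalars K') (fun μ => E.algebraMap_mem
        ⟨_, IntermediateField.subset_adjoin _ _ ⟨μ, rfl⟩⟩) h1 h2
    · intro E h1 h2 i
      have hle : IntermediateField.adjoin K' (Set.range G.coeff ∪ Set.range η) ≤ E.restrictScalars K' := by
        rw [IntermediateField.adjoin_le_iff]
        rintro _ (⟨μ, rfl⟩ | ⟨j, rfl⟩)
        · exact E.algebraMap_mem ⟨_, IntermediateField.subset_adjoin _ _ ⟨μ, rfl⟩⟩
        · exact h1 j
      have h5 : IntermediateField.adjoin (IntermediateField.adjoin K' (Set.range G.coeff ∪ Set.range η))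
          (Set.range v) ≤ IntermediateField.extendScalars hle := by
        rw [IntermediateField.adjoin_le_iff]
        rintro _ ⟨j, rfl⟩
        exact h2 _
      by_cases hi0 : (i : ℕ) = 0
      · have : i = 0 := Fin.ext hi0
        rw [this, hξ0]; exact isAlgebraic_zero
      by_cases hi1 : (i : ℕ) = 1
      · have : i = ⟨1, by omega⟩ := Fin.ext hi1
        rw [this, hξ1]; exact isAlgebraic_one
      have hlt := i.isLt
      refine isAlgebraic_of_le _ E (fun a ha => h5 ha) _ (hva _ ⟨⟨(i : ℕ) - 2, by omega⟩, ?_⟩)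
      simp only
      congr 1
      apply Fin.ext
      simp only
      omega
    · intro E h1 h2
      have h3 := aeval_mem_polyIn E G (fun μ => E.algebraMap_mem
        ⟨_, IntermediateField.subset_adjoin _ _ ⟨μ, rfl⟩⟩) (fun i : Fin (r + 1) =>
          Polynomial.C (η i) + Polynomial.X * Polynomial.C (ξ i))
        (fun i => add_mem (C_mem_polyIn E (h1 i))
          (mul_mem (X_mem_polyIn E) (C_mem_polyIn E (h2 i))))
      exact div_mem (neg_mem (h3 _)) (h3 _)
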